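/- (Theorem 2.9, (c) ⇒ (a)) Assume hypotheses (H1)–(H4). Suppose there exist τ ≥ 0, a lower semicontinuous V : [0,∞) × C([−r−τ,0]; ℝⁿ) → [0,∞), constants R ≥ 0 and c > 0, functions a₁, a₂ ∈ K∞, β₁, β₂, β₃, β₄ ∈ K⁺ with ∫₀^∞ β₄(t) dt = +∞, μ ∈ ℰ, a positive definite locally Lipschitz ρ : [0,∞) → [0,∞), and a set-valued map S̄(t) ⊆ C([−r−τ,0]; ℝⁿ) satisfying { x : a₂(β₁(t)‖x‖_{r+τ}) ≥ η(∫₀ᵗ β₄(s)ds, 0, c) } ⊆ S̄(t) for all t ≥ 0, such that: (1) a₁(|x(0)|) ≤ V(t,x) ≤ a₂(β₁(t)‖x‖_{r+τ}) for all (t,x); (2) V⁰(t, x; f(t, T_r(0)x, d)) ≤ β₂(t)V(t,x) + R·β₃(t) for all (t,x,d) ∈ [0,∞) × C([−r−τ,0]; ℝⁿ) × D; (3) V⁰(t, x; f(t, T_r(0)x, d)) ≤ −β₄(t)ρ(V(t,x)) + β₄(t)μ(∫₀ᵗ β₄(s)ds) for all t ≥ τ, d ∈ D and all x ∈ S(t).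 Then 0 ∈ C([−r,0]; ℝⁿ) is non-uniformly in time RGAS: there exist σ ∈ KL and β ∈ K⁺ such that every maximal solution with data (t₀, x₀, d) ∈ [0,∞) × C([−r,0]; ℝⁿ) × M_D is defined on [t₀,∞) and satisfies ‖T_r(t)x‖_r ≤ σ(β(t₀)‖x₀‖_r, t−t₀) for all t ≥ t₀. -/

import Mathlib

open Set Filter MeasureTheory
open scoped RealInnerProductSpace

noncomputable section

/-- ℝⁿ with the Euclidean norm. -/
abbrev Euc (n : ℕ) : Type := EuclideanSpace ℝ (Fin n)

/-- The sup norm `‖y‖_q = max_{θ ∈ [-q,0]} |y θ|` of a history segment. -/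
def histNorm (n : ℕ) (q : ℝ) (y : ℝ → Euc n) : ℝ :=
  sSup ((fun θ => ‖y θ‖) '' Icc (-q) 0)

/-- The class `M_D` of allowed disturbances: right-continuous maps `d : [0,∞) → D`
which are continuous outside a countable set with no finite accumulation point. -/
def MD (l : ℕ) (D : Set (Euc l)) (d : ℝ → Euc l) : Prop :=
  (∀ t, 0 ≤ t → d t ∈ D) ∧
  (∀ t, 0 ≤ t → ∀ ε > 0, ∃ δ > 0, ∀ s, t ≤ s → s - t < δ → ‖d s - d t‖ < ε) ∧
  ∃ A : Set ℝ, (∀ C : ℝ, (A ∩ Icc 0 C).Finite) ∧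
    ∀ t, 0 ≤ t → t ∉ A → ∀ ε > 0, ∃ δ > 0, ∀ s, 0 ≤ s → |s - t| < δ → ‖d s - d t‖ < ε

/-- The operator `E_h(x;v)`. -/
def Eop (n : ℕ) (x : ℝ → Euc n) (h : ℝ) (v : Euc n) : ℝ → Euc n :=
  fun θ => if -h < θ then x 0 + (θ + h) • v else x (θ + h)

/-- The generalized (Dini-type) derivative
`V⁰(t,x;v) = limsup_{h→0⁺, y→0} (V(t+h, E_h(x;v)+h y) - V(t,x))/h` of a functional `V`
defined on `[0,∞) × C([-q,0];ℝⁿ)`, with values in the extended reals. -/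
def Vdot (n : ℕ) (q : ℝ) (V : ℝ → (ℝ → Euc n) → ℝ) (t : ℝ)
    (x : ℝ → Euc n) (v : Euc n) : EReal :=
  ⨅ δ : Ioi (0:ℝ), ⨆ p : {p : ℝ × (ℝ → Euc n) //
      0 < p.1 ∧ p.1 < (δ : ℝ) ∧ ContinuousOn p.2 (Icc (-q) 0) ∧ histNorm n q p.2 < (δ : ℝ)},
    (((V (t + p.1.1) (fun θ => Eop n x p.1.1 v θ + p.1.1 • p.1.2 θ) - V t x) / p.1.1 : ℝ) : EReal)

/-- The upper right Dini derivative `D⁺v(t) = limsup_{h→0⁺} (v(t+h)-v(t))/h`. -/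
def DiniUpper (v : ℝ → ℝ) (t : ℝ) : EReal :=
  Filter.limsup (fun h => (((v (t + h) - v t) / h : ℝ) : EReal)) (nhdsWithin 0 (Ioi 0))

/-- Class `K∞` functions (on `[0,∞)`). -/
def IsKInf (a : ℝ → ℝ) : Prop :=
  ContinuousOn a (Ici 0) ∧ StrictMonoOn a (Ici 0) ∧ a 0 = 0 ∧
  (∀ s, 0 ≤ s → 0 ≤ a s) ∧ Filter.Tendsto a Filter.atTop Filter.atTop

/-- Class `K⁺`: positive continuous functions on `[0,∞)`. -/
def IsKPlus (b : ℝ → ℝ) : Prop :=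
  ContinuousOn b (Ici 0) ∧ ∀ t, 0 ≤ t → 0 < b t

/-- Class `KL` functions. -/
def IsKL (σ : ℝ → ℝ → ℝ) : Prop :=
  ContinuousOn (fun p : ℝ × ℝ => σ p.1 p.2) (Ici 0 ×ˢ Ici 0) ∧
  (∀ s t, 0 ≤ s → 0 ≤ t → 0 ≤ σ s t) ∧
  (∀ t, 0 ≤ t → StrictMonoOn (fun s => σ s t) (Ici 0) ∧ σ 0 t = 0) ∧
  (∀ s, 0 ≤ s → AntitoneOn (σ s) (Ici 0)) ∧
  (∀ s, 0 ≤ s → Filter.Tendsto (σ s) Filter.atTop (nhds 0))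

/-- Hypothesis (H1): a one-sided Lipschitz estimate. -/
def H1 (n l : ℕ) (r : ℝ) (D : Set (Euc l)) (f : ℝ → (ℝ → Euc n) → Euc l → Euc n) : Prop :=
  ∃ L : ℝ → ℝ → ℝ,
    ContinuousOn (fun p : ℝ × ℝ => L p.1 p.2) (Ici 0 ×ˢ Ici 0) ∧
    (∀ t, 0 ≤ t → MonotoneOn (L t) (Ici 0)) ∧
    (∀ s, 0 ≤ s → MonotoneOn (fun t => L t s) (Ici 0)) ∧
    (∀ t s, 0 ≤ t → 0 ≤ s → 0 ≤ L t s) ∧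
    ∀ t x y d, 0 ≤ t → ContinuousOn x (Icc (-r) 0) → ContinuousOn y (Icc (-r) 0) → d ∈ D →
      (inner ℝ (x 0 - y 0) (f t x d - f t y d) : ℝ) ≤
        L t (histNorm n r x + histNorm n r y) * (histNorm n r (x - y))^2

/-- Hypothesis (H2): `f` maps bounded sets to bounded sets, uniformly in `d ∈ D`. -/
def H2 (n l : ℕ) (r : ℝ) (D : Set (Euc l)) (f : ℝ → (ℝ → Euc n) → Euc l → Euc n) : Prop :=
  ∀ Tb Rb : ℝ, ∃ C : ℝ, ∀ t x d, 0 ≤ t → t ≤ Tb → ContinuousOn x (Icc (-r) 0) →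
    histNorm n r x ≤ Rb → d ∈ D → ‖f t x d‖ ≤ C

/-- Hypothesis (H3): continuity off a countable exceptional set of times with no finite
accumulation point, plus right-continuity in time everywhere. -/
def H3 (n l : ℕ) (r : ℝ) (D : Set (Euc l)) (f : ℝ → (ℝ → Euc n) → Euc l → Euc n) : Prop :=
  ∃ A : Set ℝ, (∀ C : ℝ, (A ∩ Icc 0 C).Finite) ∧
    (∀ t x d, 0 ≤ t → t ∉ A → ContinuousOn x (Icc (-r) 0) → d ∈ D →
      ∀ ε > 0, ∃ δ > 0, ∀ t' x' d', 0 ≤ t' → ContinuousOn x' (Icc (-r) 0) → d' ∈ D →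
        |t' - t| < δ → histNorm n r (x' - x) < δ → ‖d' - d‖ < δ →
          ‖f t' x' d' - f t x d‖ < ε) ∧
    (∀ t x d, 0 ≤ t → ContinuousOn x (Icc (-r) 0) → d ∈ D →
      ∀ ε > 0, ∃ δ > 0, ∀ t', t ≤ t' → t' - t < δ → ‖f t' x d - f t x d‖ < ε)

/-- Hypothesis (H4). -/
def H4 (n l : ℕ) (r : ℝ) (D : Set (Euc l)) (f : ℝ → (ℝ → Euc n) → Euc l → Euc n) : Prop :=
  ∀ ε > 0, ∀ t, 0 ≤ t → ∃ δ > 0, ∀ τ x d, 0 ≤ τ → d ∈ D → ContinuousOn x (Icc (-r) 0) →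
    |τ - t| + histNorm n r x < δ → ‖f τ x d‖ < ε

/-- A solution of the RFDE on `[t₀ - r, T)` (continuous, absolutely continuous on compact
subintervals of `[t₀,T)` and satisfying the equation a.e., expressed in integral form). -/
def IsSolIco (n l : ℕ) (r : ℝ) (f : ℝ → (ℝ → Euc n) → Euc l → Euc n) (d : ℝ → Euc l)
    (t₀ T : ℝ) (x : ℝ → Euc n) : Prop :=
  ContinuousOn x (Ico (t₀ - r) T) ∧
  ∀ t ∈ Ico t₀ T,
    IntervalIntegrable (fun s => f s (fun θ => x (s + θ)) (d s)) volume t₀ t ∧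
    x t = x t₀ + ∫ s in t₀..t, f s (fun θ => x (s + θ)) (d s)

/-- A solution of the RFDE on all of `[t₀ - r, ∞)`. -/
def IsSolGlobal (n l : ℕ) (r : ℝ) (f : ℝ → (ℝ → Euc n) → Euc l → Euc n) (d : ℝ → Euc l)
    (t₀ : ℝ) (x : ℝ → Euc n) : Prop :=
  ContinuousOn x (Ici (t₀ - r)) ∧
  ∀ t, t₀ ≤ t →
    IntervalIntegrable (fun s => f s (fun θ => x (s + θ)) (d s)) volume t₀ t ∧
    x t = x t₀ + ∫ s in t₀..t, f s (fun θ => x (s + θ)) (d s)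

/-- Non-uniform in time robust global asymptotic stability of `0` for the RFDE:
every maximal solution is defined on `[t₀,∞)` and satisfies the `KL` estimate (2.6). -/
def RGASnu (n l : ℕ) (r : ℝ) (D : Set (Euc l))
    (f : ℝ → (ℝ → Euc n) → Euc l → Euc n) : Prop :=
  ∃ σ : ℝ → ℝ → ℝ, ∃ β : ℝ → ℝ, IsKL σ ∧ IsKPlus β ∧
    (∀ t₀ x₀ d, 0 ≤ t₀ → ContinuousOn x₀ (Icc (-r) 0) → MD l D d →
      ∃ x : ℝ → Euc n, IsSolGlobal n l r f d t₀ x ∧ ∀ θ ∈ Icc (-r) 0, x (t₀ + θ) = x₀ θ) ∧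
    (∀ t₀ x₀ d x, 0 ≤ t₀ → ContinuousOn x₀ (Icc (-r) 0) → MD l D d →
      IsSolGlobal n l r f d t₀ x → (∀ θ ∈ Icc (-r) 0, x (t₀ + θ) = x₀ θ) →
      ∀ t, t₀ ≤ t →
        histNorm n r (fun θ => x (t + θ)) ≤ σ (β t₀ * histNorm n r x₀) (t - t₀))

/-- Uniform robust global asymptotic stability of `0` for the RFDE. -/
def URGAS (n l : ℕ) (r : ℝ) (D : Set (Euc l))
    (f : ℝ → (ℝ → Euc n) → Euc l → Euc n) : Prop :=
  ∃ σ : ℝ → ℝ → ℝ, IsKL σ ∧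
    (∀ t₀ x₀ d, 0 ≤ t₀ → ContinuousOn x₀ (Icc (-r) 0) → MD l D d →
      ∃ x : ℝ → Euc n, IsSolGlobal n l r f d t₀ x ∧ ∀ θ ∈ Icc (-r) 0, x (t₀ + θ) = x₀ θ) ∧
    (∀ t₀ x₀ d x, 0 ≤ t₀ → ContinuousOn x₀ (Icc (-r) 0) → MD l D d →
      IsSolGlobal n l r f d t₀ x → (∀ θ ∈ Icc (-r) 0, x (t₀ + θ) = x₀ θ) →
      ∀ t, t₀ ≤ t →
        histNorm n r (fun θ => x (t + θ)) ≤ σ (histNorm n r x₀) (t - t₀))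

/-! ### Continuous induction -/

theorem real_induction {a b : ℝ} {P : ℝ → Prop}
    (closed : ∀ t ∈ Icc a b, (∀ s ∈ Ico a t, P s) → P t)
    (step : ∀ t ∈ Ico a b, (∀ s ∈ Icc a t, P s) → ∃ δ > 0, ∀ s ∈ Ioo t (t + δ), P s) :
    ∀ t ∈ Icc a b, P t := by
  by_contra! hcon
  obtain ⟨t, ht, hPt⟩ := hcon
  set S : Set ℝ := {s | s ∈ Icc a b ∧ ¬ P s} with hS
  have hne : S.Nonempty := ⟨t, ht, hPt⟩
  have hbdd : BddBelow S := ⟨a, fun s hs => hs.1.1⟩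
  have ham : a ≤ sInf S := le_csInf hne fun s hs => hs.1.1
  have hmt : sInf S ≤ t := csInf_le hbdd ⟨ht, hPt⟩
  have hlt : ∀ s ∈ Ico a (sInf S), P s := by
    intro s hs
    by_contra hP
    exact absurd (csInf_le hbdd ⟨⟨hs.1, by linarith [hs.2, ht.2]⟩, hP⟩) (not_le.2 hs.2)
  have hPm : P (sInf S) := closed _ ⟨ham, hmt.trans ht.2⟩ hlt
  have hmt' : sInf S < t := lt_of_le_of_ne hmt fun h => hPt (h ▸ hPm)
  obtain ⟨δ, hδ, hstep⟩ := step (sInf S) ⟨ham, hmt'.trans_le ht.2⟩ (by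
    intro s hs
    rcases hs.2.lt_or_eq with h | h
    · exact hlt s ⟨hs.1, h⟩
    · exact h ▸ hPm)
  obtain ⟨s, hsS, hs⟩ := exists_lt_of_csInf_lt hne (show sInf S < sInf S + δ by linarith)
  rcases (csInf_le hbdd hsS).lt_or_eq with h | h
  · exact hsS.2 (hstep s ⟨h, hs⟩)
  · exact hsS.2 (h ▸ hPm)

/-! ### The sup norm of history segments -/

section HistNorm

variable {n : ℕ} {q : ℝ} {y : ℝ → Euc n}

theorem histNorm_le {M : ℝ} (hM : 0 ≤ M) (h : ∀ θ ∈ Icc (-q) 0, ‖y θ‖ ≤ M) :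
    histNorm n q y ≤ M := by
  apply Real.sSup_le _ hM
  rintro _ ⟨θ, hθ, rfl⟩
  exact h θ hθ

theorem norm_le_histNorm (hy : ContinuousOn y (Icc (-q) 0)) {θ : ℝ} (hθ : θ ∈ Icc (-q) 0) :
    ‖y θ‖ ≤ histNorm n q y :=
  le_csSup (isCompact_Icc.image_of_continuousOn hy.norm).bddAbove ⟨θ, hθ, rfl⟩

theorem histNorm_nonneg : 0 ≤ histNorm n q y := by
  apply Real.sSup_nonneg
  rintro _ ⟨θ, _, rfl⟩
  exact norm_nonneg _

end HistNorm

/-- The history segment of a continuous curve depends continuously on time. -/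
theorem exists_histNorm_shift_lt {n : ℕ} {x : ℝ → Euc n} (hx : Continuous x) (q t : ℝ) {ε : ℝ}
    (hε : 0 < ε) : ∃ δ > 0, ∀ s, |s - t| < δ →
      histNorm n q ((fun θ => x (s + θ)) - fun θ => x (t + θ)) < ε := by
  have huc := (isCompact_Icc (a := t - q - 1) (b := t + 1)).uniformContinuousOn_of_continuous
    hx.continuousOn
  rw [Metric.uniformContinuousOn_iff] at huc
  obtain ⟨δ, hδ, h⟩ := huc (ε / 2) (by linarith)
  refine ⟨min δ 1, by positivity, fun s hs => ?_⟩
  have hs1 := lt_of_lt_of_le hs (min_le_left _ _)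
  have hs2 := abs_lt.1 (lt_of_lt_of_le hs (min_le_right _ _))
  refine lt_of_le_of_lt (histNorm_le (by linarith) fun θ hθ => ?_) (half_lt_self hε)
  have := h (s + θ) ⟨by linarith [hθ.1], by linarith [hθ.2]⟩ (t + θ)
    ⟨by linarith [hθ.1], by linarith [hθ.2]⟩ (by
    rwa [Real.dist_eq, add_sub_add_right_eq_sub])
  rw [dist_eq_norm] at this
  exact this.le

theorem exists_bound_of_continuous {n : ℕ} {x : ℝ → Euc n} (hx : Continuous x) (a b : ℝ) :
    ∃ M, 0 ≤ M ∧ ∀ t ∈ Icc a b, ‖x t‖ ≤ M := by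
  obtain ⟨M, hM⟩ := (isCompact_Icc (a := a) (b := b)).exists_bound_of_continuousOn hx.continuousOn
  exact ⟨max M 0, le_max_right _ _, fun t ht => (hM t ht).trans (le_max_left _ _)⟩

/-- A locally finite set of exceptional times is avoided immediately after any given time. -/
theorem exists_right_gap {A : Set ℝ} (hA : ∀ C : ℝ, (A ∩ Icc 0 C).Finite) {t : ℝ} (ht : 0 ≤ t) :
    ∃ δ > 0, ∀ s ∈ Ioc t (t + δ), s ∉ A := by
  have hfin : ((A ∩ Icc 0 (t + 1)) \ {t}).Finite := (hA (t + 1)).subset sdiff_subset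
  have hopen := hfin.isClosed.isOpen_compl
  obtain ⟨δ, hδ, h⟩ := Metric.isOpen_iff.1 hopen t (by simp)
  refine ⟨min (δ / 2) 1, by positivity, fun s hs hsA => ?_⟩
  have h1 := min_le_left (δ / 2) 1
  have h2 := min_le_right (δ / 2) 1
  have := h (show s ∈ Metric.ball t δ by
    rw [Metric.mem_ball, Real.dist_eq, abs_lt]; constructor <;> linarith [hs.1, hs.2])
  exact this ⟨⟨hsA, by linarith [hs.1], by linarith [hs.2]⟩, by simpa using hs.1.ne'⟩

/-! ### Regularity of the right-hand side along continuous curves -/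

section Rhs

variable {n l : ℕ} {r : ℝ} {D : Set (Euc l)} {f : ℝ → (ℝ → Euc n) → Euc l → Euc n}

/-- The right-hand side only depends on the restriction of the history to `[-r, 0]`. -/
theorem H3.congr (h3 : H3 n l r D f) {t : ℝ} (ht : 0 ≤ t) {x y : ℝ → Euc n}
    (hx : ContinuousOn x (Icc (-r) 0)) (hxy : EqOn y x (Icc (-r) 0)) {d : Euc l} (hd : d ∈ D) :
    f t y d = f t x d := by
  obtain ⟨A, hA, hcont, hright⟩ := h3
  have hy : ContinuousOn y (Icc (-r) 0) := hx.congr hxy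
  have hzero : histNorm n r (y - x) ≤ 0 := histNorm_le le_rfl fun θ hθ => by
    simp [hxy hθ]
  have hoff : ∀ s, 0 ≤ s → s ∉ A → f s y d = f s x d := by
    intro s hs hsA
    by_contra hne
    have hpos : 0 < ‖f s y d - f s x d‖ := norm_pos_iff.2 (sub_ne_zero.2 hne)
    obtain ⟨δ, hδ, h⟩ := hcont s x d hs hsA hx hd _ hpos
    exact lt_irrefl _ (h s y d hs hy hd (by simpa) (by linarith) (by simpa))
  by_contra hne
  have hpos : 0 < ‖f t y d - f t x d‖ := norm_pos_iff.2 (sub_ne_zero.2 hne)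
  obtain ⟨δ₁, hδ₁, h₁⟩ := hright t x d ht hx hd _ (half_pos hpos)
  obtain ⟨δ₂, hδ₂, h₂⟩ := hright t y d ht hy hd _ (half_pos hpos)
  obtain ⟨δ₃, hδ₃, h₃⟩ := exists_right_gap hA ht
  set δ := min (min (δ₁ / 2) (δ₂ / 2)) δ₃ with hδdef
  have hδ : 0 < δ := by positivity
  have e1 : δ ≤ δ₁ / 2 := (min_le_left _ _).trans (min_le_left _ _)
  have e2 : δ ≤ δ₂ / 2 := (min_le_left _ _).trans (min_le_right _ _)
  have e3 : δ ≤ δ₃ := min_le_right _ _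
  have k1 := h₁ (t + δ) (by linarith) (by linarith)
  have k2 := h₂ (t + δ) (by linarith) (by linarith)
  have k3 := hoff (t + δ) (by linarith) (h₃ _ ⟨by linarith, by linarith⟩)
  rw [k3] at k2
  have : ‖f t y d - f t x d‖ ≤ ‖f (t + δ) x d - f t x d‖ + ‖f (t + δ) x d - f t y d‖ := by
    have : f t y d - f t x d = (f (t + δ) x d - f t x d) - (f (t + δ) x d - f t y d) := by abel
    rw [this]; exact norm_sub_le _ _
  linarith

/-- Outside the exceptional times the right-hand side along a continuous curve is
right-continuous. -/
theorem H3.exists_right (h3 : H3 n l r D f) : ∃ A : Set ℝ, (∀ C : ℝ, (A ∩ Icc 0 C).Finite) ∧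
    ∀ d, MD l D d → ∀ x, Continuous x → ∀ t, 0 ≤ t → t ∉ A → ∀ ε > 0, ∃ δ > 0,
      ∀ s ∈ Ico t (t + δ), ‖f s (fun θ => x (s + θ)) (d s) - f t (fun θ => x (t + θ)) (d t)‖ < ε := by
  obtain ⟨A, hA, hcont, -⟩ := h3
  refine ⟨A, hA, fun d hd x hx t ht htA ε hε => ?_⟩
  obtain ⟨δ, hδ, h⟩ := hcont t (fun θ => x (t + θ)) (d t) ht htA (by fun_prop) (hd.1 t ht) ε hε
  obtain ⟨δ₁, hδ₁, h₁⟩ := hd.2.1 t ht δ hδ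
  obtain ⟨δ₂, hδ₂, h₂⟩ := exists_histNorm_shift_lt hx r t hδ
  refine ⟨min δ (min δ₁ δ₂), by positivity, fun s hs => ?_⟩
  have hst : s - t < min δ (min δ₁ δ₂) := by linarith [hs.2]
  have e0 : |s - t| = s - t := abs_of_nonneg (by linarith [hs.1])
  have hst' := lt_min_iff.1 (lt_min_iff.1 hst).2
  have hs0 : 0 ≤ s := ht.trans hs.1
  exact h s _ (d s) hs0 (by fun_prop) (hd.1 s hs0) (e0.trans_lt (lt_min_iff.1 hst).1)
    (h₂ s (e0.trans_lt hst'.2)) (h₁ s hs.1 hst'.1)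

theorem H3.exists_continuousAt (h3 : H3 n l r D f) {d : ℝ → Euc l} (hd : MD l D d) :
    ∃ A : Set ℝ, (∀ C : ℝ, (A ∩ Icc 0 C).Finite) ∧ ∀ x, Continuous x → ∀ t, 0 < t → t ∉ A →
      ContinuousAt (fun s => f s (fun θ => x (s + θ)) (d s)) t := by
  obtain ⟨A, hA, hcont, -⟩ := h3
  obtain ⟨hdD, -, B, hB, hdcont⟩ := hd
  refine ⟨A ∪ B, fun C => by rw [union_inter_distrib_right]; exact (hA C).union (hB C), ?_⟩
  intro x hx t ht htAB
  have htA : t ∉ A := fun h => htAB (Or.inl h)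
  have htB : t ∉ B := fun h => htAB (Or.inr h)
  rw [Metric.continuousAt_iff]
  intro ε hε
  obtain ⟨δ, hδ, h⟩ := hcont t (fun θ => x (t + θ)) (d t) ht.le htA (by fun_prop) (hdD t ht.le) ε hε
  obtain ⟨δ₁, hδ₁, h₁⟩ := hdcont t ht.le htB δ hδ
  obtain ⟨δ₂, hδ₂, h₂⟩ := exists_histNorm_shift_lt hx r t hδ
  refine ⟨min (min δ t) (min δ₁ δ₂), by positivity, fun {s} hs => ?_⟩
  rw [Real.dist_eq] at hs
  simp only [lt_min_iff] at hs
  have hs0 : 0 ≤ s := by linarith [abs_lt.1 hs.1.2]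
  rw [dist_eq_norm]
  exact h s _ (d s) hs0 (by fun_prop) (hdD s hs0) hs.1.1 (h₂ s hs.2.2) (h₁ s hs0 hs.2.1)

/-- At almost every time the right-hand side is continuous with respect to uniform convergence of
the curves. -/
theorem H3.tendsto_of_uniform (h3 : H3 n l r D f) {d : ℝ → Euc l} (hd : MD l D d) :
    ∃ A : Set ℝ, (∀ C : ℝ, (A ∩ Icc 0 C).Finite) ∧ ∀ s, 0 ≤ s → s ∉ A →
      ∀ (X : ℕ → ℝ → Euc n) (x : ℝ → Euc n), (∀ k, Continuous (X k)) → Continuous x →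
      (∀ ε > 0, ∀ᶠ k in atTop, ∀ t ≤ s, ‖X k t - x t‖ ≤ ε) →
      Tendsto (fun k => f s (fun θ => X k (s + θ)) (d s)) atTop
        (nhds (f s (fun θ => x (s + θ)) (d s))) := by
  obtain ⟨A, hA, hcont, -⟩ := h3
  refine ⟨A, hA, fun s hs hsA X x hX hx hlim => ?_⟩
  rw [Metric.tendsto_nhds]
  intro ε hε
  obtain ⟨δ, hδ, h⟩ := hcont s (fun θ => x (s + θ)) (d s) hs hsA (by fun_prop) (hd.1 s hs) ε hε
  filter_upwards [hlim (δ / 2) (half_pos hδ)] with k hk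
  rw [dist_eq_norm]
  refine h s _ (d s) hs ?_ (hd.1 s hs) (by simpa) ?_ (by simpa)
  · have := hX k
    fun_prop
  · refine lt_of_le_of_lt (histNorm_le (half_pos hδ).le fun θ hθ => ?_) (half_lt_self hδ)
    exact hk _ (by linarith [hθ.2])

theorem finite_inter_Icc_of_locallyFinite {A : Set ℝ} (hA : ∀ C : ℝ, (A ∩ Icc 0 C).Finite) (a b : ℝ)
    (ha : 0 ≤ a) : (A ∩ Icc a b).Finite :=
  (hA b).subset fun _ hs => ⟨hs.1, ha.trans hs.2.1, hs.2.2⟩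

theorem H3.aestronglyMeasurable (h3 : H3 n l r D f) {d : ℝ → Euc l} (hd : MD l D d)
    {x : ℝ → Euc n} (hx : Continuous x) {a : ℝ} (ha : 0 ≤ a) (b : ℝ) :
    AEStronglyMeasurable (fun s => f s (fun θ => x (s + θ)) (d s)) (volume.restrict (Ioc a b)) := by
  obtain ⟨A, hA, hcont⟩ := h3.exists_continuousAt hd
  have hfin := finite_inter_Icc_of_locallyFinite hA a b ha
  have hmeas : MeasurableSet (Ioo a b \ (A ∩ Icc a b)) :=
    measurableSet_Ioo.diff hfin.measurableSet
  have h1 : AEStronglyMeasurable (fun s => f s (fun θ => x (s + θ)) (d s))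
      (volume.restrict (Ioo a b \ (A ∩ Icc a b))) := by
    apply ContinuousOn.aestronglyMeasurable _ hmeas
    intro s hs
    exact (hcont x hx s (ha.trans_lt hs.1.1)
      fun h => hs.2 ⟨h, hs.1.1.le, hs.1.2.le⟩).continuousWithinAt
  have h2 : (Ioo a b \ (A ∩ Icc a b) : Set ℝ) =ᵐ[volume] Ioc a b :=
    (sdiff_null_ae_eq_self (hfin.measure_zero _)).trans Ioo_ae_eq_Ioc
  rwa [Measure.restrict_congr_set h2] at h1

theorem H3.intervalIntegrable (h3 : H3 n l r D f) (h2 : H2 n l r D f) {d : ℝ → Euc l}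
    (hd : MD l D d) {x : ℝ → Euc n} (hx : Continuous x) {a b : ℝ} (ha : 0 ≤ a) (hb : 0 ≤ b) :
    IntervalIntegrable (fun s => f s (fun θ => x (s + θ)) (d s)) volume a b := by
  suffices h : ∀ a b : ℝ, 0 ≤ a →
      IntegrableOn (fun s => f s (fun θ => x (s + θ)) (d s)) (Ioc a b) volume from
    ⟨h a b ha, h b a hb⟩
  intro a b ha
  obtain ⟨M, hM0, hM⟩ := exists_bound_of_continuous hx (a - r) b
  obtain ⟨C, hC⟩ := h2 b M
  refine IntegrableOn.of_bound measure_Ioc_lt_top (h3.aestronglyMeasurable hd hx ha b) C ?_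
  filter_upwards [ae_restrict_mem measurableSet_Ioc] with s hs
  have hs0 : 0 ≤ s := ha.trans hs.1.le
  exact hC s _ _ hs0 hs.2 (by fun_prop) (histNorm_le hM0 fun θ hθ =>
    hM _ ⟨by linarith [hs.1, hθ.1], by linarith [hs.2, hθ.2]⟩) (hd.1 s hs0)

end Rhs

/-! ### Existence of solutions for bounded causal right-hand sides -/

section Existence

variable {E : Type*} [NormedAddCommGroup E]

/-- The curve which starts as `φ` up to time `a` and is then displaced by `w`. -/
def displaced (φ : ℝ → E) (a : ℝ) (w : ℝ → E) : ℝ → E := fun t => φ (min t a) + w t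

theorem Continuous.displaced {φ : ℝ → E} (hφ : Continuous φ) (a : ℝ) {w : ℝ → E}
    (hw : Continuous w) : Continuous (displaced φ a w) := by
  unfold _root_.displaced
  fun_prop

variable {G : ℝ → (ℝ → E) → E} {a b C : ℝ}

theorem intervalIntegrable_of_bounded_of_subinterval
    (hmeas : ∀ x, Continuous x →
      AEStronglyMeasurable (fun s => G s x) (volume.restrict (Ioc a b)))
    (hbd : ∀ x, Continuous x → ∀ s ∈ Ioc a b, ‖G s x‖ ≤ C)
    {x : ℝ → E} (hx : Continuous x) {p q : ℝ} (hp : p ∈ Icc a b) (hq : q ∈ Icc a b) :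
    IntervalIntegrable (fun s => G s x) volume p q := by
  have h : IntegrableOn (fun s => G s x) (Ioc a b) volume := by
    refine IntegrableOn.of_bound measure_Ioc_lt_top (hmeas x hx) C ?_
    filter_upwards [ae_restrict_mem measurableSet_Ioc] with s hs
    exact hbd x hx s hs
  exact ⟨h.mono_set (Ioc_subset_Ioc hp.1 hq.2), h.mono_set (Ioc_subset_Ioc hq.1 hp.2)⟩

variable [NormedSpace ℝ E]

theorem norm_integral_le_of_bounded_of_subinterval
    (hbd : ∀ x, Continuous x → ∀ s ∈ Ioc a b, ‖G s x‖ ≤ C)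
    {x : ℝ → E} (hx : Continuous x) {p q : ℝ} (hp : p ∈ Icc a b) (hq : q ∈ Icc a b) :
    ‖∫ s in p..q, G s x‖ ≤ C * |q - p| := by
  refine intervalIntegral.norm_integral_le_of_norm_le_const fun s hs => hbd x hx s ?_
  rw [uIoc, mem_Ioc] at hs
  exact ⟨(le_min hp.1 hq.1).trans_lt hs.1, hs.2.trans (max_le hp.2 hq.2)⟩

/-- Tonelli's delayed approximation: the integral equation with the upper limit delayed by `δ` is
solvable by finitely many iterations. -/
theorem exists_delayed_solution (hab : a ≤ b)
    (hmeas : ∀ x, Continuous x →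
      AEStronglyMeasurable (fun s => G s x) (volume.restrict (Ioc a b)))
    (hbd : ∀ x, Continuous x → ∀ s ∈ Ioc a b, ‖G s x‖ ≤ C) (hC : 0 ≤ C)
    (hcausal : ∀ x y, Continuous x → Continuous y → ∀ s ∈ Ioc a b, (∀ u ≤ s, x u = y u) →
      G s x = G s y)
    {φ : ℝ → E} (hφ : Continuous φ) {δ : ℝ} (hδ : 0 < δ) :
    ∃ w : ℝ → E, Continuous w ∧ (∀ s t, ‖w s - w t‖ ≤ C * |s - t|) ∧ (∀ t ≤ a, w t = 0) ∧
      ∀ t ∈ Icc a b, w t = ∫ s in a..max a (t - δ), G s (displaced φ a w) := by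
  set P : (ℝ → E) → ℝ → E := fun w t =>
    ∫ s in a..max a (min t b - δ), G s (displaced φ a w) with hP
  have hmem : ∀ t, max a (min t b - δ) ∈ Icc a b := fun t =>
    ⟨le_max_left _ _, max_le hab (by linarith [min_le_right t b])⟩
  have hPlip : ∀ w, Continuous w → ∀ s t, ‖P w s - P w t‖ ≤ C * |s - t| := by
    intro w hw s t
    have hx := hφ.displaced a hw
    rw [hP, intervalIntegral.integral_interval_sub_left
      (intervalIntegrable_of_bounded_of_subinterval hmeas hbd hx (left_mem_Icc.2 hab) (hmem s))
      (intervalIntegrable_of_bounded_of_subinterval hmeas hbd hx (left_mem_Icc.2 hab) (hmem t))]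
    refine (norm_integral_le_of_bounded_of_subinterval hbd hx (hmem t) (hmem s)).trans ?_
    refine mul_le_mul_of_nonneg_left ?_ hC
    refine (abs_max_sub_max_le_max a _ a _).trans (max_le (by rw [sub_self, abs_zero]; positivity) ?_)
    rw [sub_sub_sub_cancel_right]
    exact (abs_min_sub_min_le_max s b t b).trans
      (max_le le_rfl (by rw [sub_self, abs_zero]; positivity))
  have hcont_of_lip : ∀ w : ℝ → E, (∀ s t, ‖w s - w t‖ ≤ C * |s - t|) → Continuous w := by
    intro w hw
    refine (LipschitzWith.of_dist_le_mul (K := ⟨C, hC⟩) fun s t => ?_).continuous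
    rw [dist_eq_norm, Real.dist_eq]
    exact hw s t
  set W : ℕ → ℝ → E := fun j => P^[j] 0 with hW
  have hWsucc : ∀ j, W (j + 1) = P (W j) := fun j => Function.iterate_succ_apply' P j 0
  have hWlip : ∀ j, ∀ s t, ‖W j s - W j t‖ ≤ C * |s - t| := by
    intro j
    induction j with
    | zero => intro s t; simp only [hW, Function.iterate_zero, id]; simp; positivity
    | succ j ih => rw [hWsucc]; exact hPlip _ (hcont_of_lip _ ih)
  have hWcont : ∀ j, Continuous (W j) := fun j => hcont_of_lip _ (hWlip j)
  have hWagree : ∀ j : ℕ, ∀ t ≤ a + j * δ, W (j + 1) t = W j t := by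
    intro j
    induction j with
    | zero =>
      intro t ht
      simp only [Nat.cast_zero, zero_mul, add_zero] at ht
      rw [hWsucc]
      have : max a (min t b - δ) = a := max_eq_left (by linarith [min_le_left t b])
      simp [hP, hW, this]
    | succ j ih =>
      intro t ht
      rw [congrFun (hWsucc (j + 1)) t, congrFun (hWsucc j) t]
      refine intervalIntegral.integral_congr_ae (Eventually.of_forall fun s hs => ?_)
      rw [uIoc_of_le (hmem t).1] at hs
      refine hcausal _ _ (hφ.displaced a (hWcont _)) (hφ.displaced a (hWcont _)) s
        ⟨hs.1, hs.2.trans (hmem t).2⟩ fun u hu => ?_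
      have hs2 : s ≤ min t b - δ := (le_max_iff.1 hs.2).resolve_left (not_le.2 hs.1)
      push_cast at ht
      simp only [displaced]
      rw [ih u (by linarith [min_le_left t b])]
  obtain ⟨N, hN⟩ := exists_nat_gt ((b - a) / δ)
  rw [div_lt_iff₀ hδ] at hN
  refine ⟨W N, hWcont N, hWlip N, fun t ht => ?_, fun t ht => ?_⟩
  · rw [← hWagree N t (by nlinarith [Nat.cast_nonneg (α := ℝ) N]), hWsucc]
    have : max a (min t b - δ) = a := max_eq_left (by linarith [min_le_left t b])
    simp [hP, this]
  · rw [← hWagree N t (by linarith [ht.2]), hWsucc]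
    simp only [hP]
    rw [min_eq_left ht.2]

/-- Peano's theorem for bounded causal right-hand sides of Carathéodory type. -/
theorem exists_solution_of_bounded [ProperSpace E] (hab : a ≤ b)
    (hmeas : ∀ x, Continuous x →
      AEStronglyMeasurable (fun s => G s x) (volume.restrict (Ioc a b)))
    (hbd : ∀ x, Continuous x → ∀ s ∈ Ioc a b, ‖G s x‖ ≤ C) (hC : 0 ≤ C)
    (hcausal : ∀ x y, Continuous x → Continuous y → ∀ s ∈ Ioc a b, (∀ u ≤ s, x u = y u) →
      G s x = G s y)
    (hlim : ∀ᵐ s ∂volume.restrict (Ioc a b), ∀ (X : ℕ → ℝ → E) (x : ℝ → E),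
      (∀ k, Continuous (X k)) → Continuous x →
      (∀ ε > 0, ∀ᶠ k in atTop, ∀ t ≤ s, ‖X k t - x t‖ ≤ ε) →
      Tendsto (fun k => G s (X k)) atTop (nhds (G s x)))
    {φ : ℝ → E} (hφ : Continuous φ) :
    ∃ x : ℝ → E, Continuous x ∧ (∀ t ≤ a, x t = φ t) ∧
      ∀ t ∈ Icc a b, x t = φ a + ∫ s in a..t, G s x := by
  have hδpos : ∀ k : ℕ, (0 : ℝ) < 1 / ((k : ℝ) + 1) := fun k => Nat.one_div_pos_of_nat
  choose w hwc hwlip hwzero hweq using fun k : ℕ =>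
    exists_delayed_solution hab hmeas hbd hC hcausal hφ (hδpos k)
  set U : ℕ → BoundedContinuousFunction (Icc a b) E := fun k =>
    BoundedContinuousFunction.mkOfCompact ⟨fun t => w k t, by have := hwc k; fun_prop⟩ with hU
  have hcompact : IsCompact (closure (range U)) := by
    refine BoundedContinuousFunction.arzela_ascoli (Metric.closedBall 0 (C * (b - a)))
      (isCompact_closedBall _ _) _ ?_ ?_
    · rintro _ t ⟨k, rfl⟩
      rw [mem_closedBall_zero_iff]
      have := hwlip k t a
      rw [hwzero k a le_rfl, sub_zero, abs_of_nonneg (by linarith [t.2.1])] at this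
      refine this.trans ?_
      gcongr
      exact t.2.2
    · intro t
      rw [Metric.equicontinuousAt_iff]
      intro ε hε
      refine ⟨ε / (C + 1), by positivity, ?_⟩
      rintro s hs ⟨_, k, rfl⟩
      rw [Subtype.dist_eq, Real.dist_eq, lt_div_iff₀ (by positivity)] at hs
      rw [dist_eq_norm]
      refine (hwlip k t s).trans_lt ?_
      rw [abs_sub_comm]
      nlinarith [abs_nonneg ((s : ℝ) - t)]
  obtain ⟨u, -, ψ, hψ, hconv⟩ := hcompact.tendsto_subseq (x := U) fun k =>
    subset_closure (mem_range_self k)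
  set v : ℝ → E := fun t => u (projIcc a b hab t) with hv
  have hvc : Continuous v := u.continuous.comp continuous_projIcc
  have huni : ∀ k, ∀ t ≤ b, ‖w (ψ k) t - v t‖ ≤ dist (U (ψ k)) u := by
    intro k t ht
    have h1 : w (ψ k) t = U (ψ k) (projIcc a b hab t) := by
      rcases le_total t a with h | h
      · rw [projIcc_of_le_left hab h, hwzero _ t h]
        exact (hwzero (ψ k) a le_rfl).symm
      · rw [projIcc_of_mem hab ⟨h, ht⟩]; rfl
    rw [h1, ← dist_eq_norm]
    exact BoundedContinuousFunction.dist_coe_le_dist _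
  have hdist : Tendsto (fun k => dist (U (ψ k)) u) atTop (nhds 0) :=
    tendsto_iff_dist_tendsto_zero.1 hconv
  have hpt : ∀ t ≤ b, Tendsto (fun k => w (ψ k) t) atTop (nhds (v t)) := by
    intro t ht
    rw [tendsto_iff_norm_sub_tendsto_zero]
    exact squeeze_zero (fun _ => norm_nonneg _) (fun k => huni k t ht) hdist
  have hvzero : ∀ t ≤ a, v t = 0 := by
    intro t ht
    refine tendsto_nhds_unique (hpt t (ht.trans hab)) ?_
    simp [hwzero _ t ht]
  have hxc := hφ.displaced a hvc
  refine ⟨displaced φ a v, hxc, fun t ht => ?_, fun t ht => ?_⟩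
  · simp [displaced, min_eq_left ht, hvzero t ht]
  have hintegrable : Tendsto (fun k => ∫ s in a..t, G s (displaced φ a (w (ψ k)))) atTop
      (nhds (∫ s in a..t, G s (displaced φ a v))) := by
    refine intervalIntegral.tendsto_integral_filter_of_dominated_convergence (fun _ => C) ?_ ?_
      (by simp) ?_
    · refine Eventually.of_forall fun k => ?_
      rw [uIoc_of_le ht.1]
      exact (hmeas _ (hφ.displaced a (hwc _))).mono_set (Ioc_subset_Ioc le_rfl ht.2)
    · refine Eventually.of_forall fun k => Eventually.of_forall fun s hs => ?_
      rw [uIoc_of_le ht.1] at hs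
      exact hbd _ (hφ.displaced a (hwc _)) s ⟨hs.1, hs.2.trans ht.2⟩
    · rw [ae_restrict_iff' measurableSet_Ioc] at hlim
      filter_upwards [hlim] with s hs hst
      rw [uIoc_of_le ht.1] at hst
      have hsb := hst.2.trans ht.2
      refine hs ⟨hst.1, hsb⟩ _ _ (fun k => hφ.displaced a (hwc _)) hxc fun ε hε => ?_
      filter_upwards [hdist.eventually (gt_mem_nhds hε)] with k hk p hp
      simp only [displaced, add_sub_add_left_eq_sub]
      exact (huni k p (hp.trans hsb)).trans hk.le
  have hdiff : Tendsto (fun k => w (ψ k) t - ∫ s in a..t, G s (displaced φ a (w (ψ k)))) atTop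
      (nhds 0) := by
    have hδ0 : Tendsto (fun k => C * (1 / ((ψ k : ℝ) + 1))) atTop (nhds 0) := by
      have := (tendsto_one_div_add_atTop_nhds_zero_nat (𝕜 := ℝ)).comp hψ.tendsto_atTop
      simpa using this.const_mul C
    refine squeeze_zero_norm (fun k => ?_) hδ0
    have hx := hφ.displaced a (hwc (ψ k))
    have hm : max a (t - 1 / ((ψ k : ℝ) + 1)) ∈ Icc a b :=
      ⟨le_max_left _ _, max_le hab (by linarith [hδpos (ψ k), ht.2])⟩
    have haI := left_mem_Icc.2 hab
    rw [hweq (ψ k) t ht, intervalIntegral.integral_interval_sub_left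
      (intervalIntegrable_of_bounded_of_subinterval hmeas hbd hx haI hm)
      (intervalIntegrable_of_bounded_of_subinterval hmeas hbd hx haI ht)]
    refine (norm_integral_le_of_bounded_of_subinterval hbd hx ht hm).trans ?_
    gcongr
    rw [abs_le]
    have := hδpos (ψ k)
    constructor
    · linarith [le_max_right a (t - 1 / ((ψ k : ℝ) + 1))]
    · linarith [max_le ht.1 (show t - 1 / ((ψ k : ℝ) + 1) ≤ t by linarith)]
  have := tendsto_nhds_unique (hdiff.add hintegrable) (by simpa using hpt t ht.2)
  rw [zero_add] at this
  simp only [displaced, min_eq_right ht.1]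
  rw [← this]

end Existence

/-! ### Truncation -/

/-- Coordinatewise truncation at level `M`. -/
def clip (n : ℕ) (M : ℝ) (v : Euc n) : Euc n := WithLp.toLp 2 fun i => max (-M) (min M (v i))

section Clip

variable {n : ℕ} {M : ℝ}

theorem norm_clip_sub_clip_le (u v : Euc n) : ‖clip n M u - clip n M v‖ ≤ ‖u - v‖ := by
  rw [EuclideanSpace.norm_eq, EuclideanSpace.norm_eq]
  refine Real.sqrt_le_sqrt (Finset.sum_le_sum fun i _ => ?_)
  gcongr
  simp only [clip, PiLp.sub_apply, Real.norm_eq_abs]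
  refine (abs_max_sub_max_le_max (-M) _ (-M) _).trans
    (max_le (by rw [sub_self, abs_zero]; positivity) ?_)
  exact (abs_min_sub_min_le_max M _ M _).trans (max_le (by rw [sub_self, abs_zero]; positivity) le_rfl)

theorem continuous_clip : Continuous (clip n M) := by
  refine (LipschitzWith.of_dist_le_mul (K := 1) fun u v => ?_).continuous
  rw [dist_eq_norm, dist_eq_norm, NNReal.coe_one, one_mul]
  exact norm_clip_sub_clip_le u v

theorem clip_of_norm_le {v : Euc n} (hv : ‖v‖ ≤ M) : clip n M v = v := by
  ext i
  have h := abs_le.1 ((Real.norm_eq_abs _ ▸ PiLp.norm_apply_le v i).trans hv)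
  simp only [clip]
  rw [min_eq_right h.2, max_eq_right h.1]

theorem exists_norm_clip_le (n : ℕ) (M : ℝ) : ∃ C, 0 ≤ C ∧ ∀ v : Euc n, ‖clip n M v‖ ≤ C := by
  refine ⟨√(∑ _i : Fin n, M ^ 2), Real.sqrt_nonneg _, fun v => ?_⟩
  rw [EuclideanSpace.norm_eq]
  refine Real.sqrt_le_sqrt (Finset.sum_le_sum fun i _ => ?_)
  rw [sq_le_sq, Real.norm_eq_abs, abs_abs]
  simp only [clip]
  rw [abs_le]
  constructor
  · exact (neg_le_neg (le_abs_self M)).trans (le_max_left _ _)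
  · exact max_le (neg_le_abs M) ((min_le_left _ _).trans (le_abs_self M))

end Clip

section Truncation

variable {n l : ℕ} {r : ℝ} {D : Set (Euc l)} {f : ℝ → (ℝ → Euc n) → Euc l → Euc n}

theorem H3.clip (h3 : H3 n l r D f) (M : ℝ) :
    H3 n l r D (fun t x d => f t (fun θ => clip n M (x θ)) d) := by
  obtain ⟨A, hA, hcont, hright⟩ := h3
  have hc : ∀ x : ℝ → Euc n, ContinuousOn x (Icc (-r) 0) →
      ContinuousOn (fun θ => _root_.clip n M (x θ)) (Icc (-r) 0) :=
    fun x hx => continuous_clip.comp_continuousOn hx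
  refine ⟨A, hA, fun t x d ht htA hx hd ε hε => ?_, fun t x d ht hx hd => hright t _ d ht (hc x hx) hd⟩
  obtain ⟨δ, hδ, h⟩ := hcont t _ d ht htA (hc x hx) hd ε hε
  refine ⟨δ, hδ, fun t' x' d' ht' hx' hd' h1 h2 h3 => h t' _ d' ht' (hc x' hx') hd' h1 ?_ h3⟩
  refine lt_of_le_of_lt (histNorm_le histNorm_nonneg fun θ hθ => ?_) h2
  exact (norm_clip_sub_clip_le _ _).trans (norm_le_histNorm (hx'.sub hx) hθ)

theorem H2.exists_clip_bound (h2 : H2 n l r D f) (T M : ℝ) : ∃ C, 0 ≤ C ∧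
    ∀ t, 0 ≤ t → t ≤ T → ∀ x : ℝ → Euc n, Continuous x → ∀ d ∈ D,
      ‖f t (fun θ => clip n M (x θ)) d‖ ≤ C := by
  obtain ⟨K, hK0, hK⟩ := exists_norm_clip_le n M
  obtain ⟨C, hC⟩ := h2 T K
  refine ⟨max C 0, le_max_right _ _, fun t ht htT x hx d hd => le_max_of_le_left ?_⟩
  exact hC t _ d ht htT (continuous_clip.comp hx).continuousOn
    (histNorm_le hK0 fun θ _ => hK _) hd

theorem exists_truncated_solution (h2 : H2 n l r D f) (h3 : H3 n l r D f) {d : ℝ → Euc l}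
    (hd : MD l D d) {a b : ℝ} (ha : 0 ≤ a) (hab : a ≤ b) (M : ℝ) {φ : ℝ → Euc n}
    (hφ : Continuous φ) : ∃ x : ℝ → Euc n, Continuous x ∧ (∀ t ≤ a, x t = φ t) ∧
      ∀ t ∈ Icc a b, x t = φ a + ∫ s in a..t, f s (fun θ => clip n M (x (s + θ))) (d s) := by
  obtain ⟨C, hC0, hC⟩ := h2.exists_clip_bound b M
  refine exists_solution_of_bounded
    (G := fun s x => f s (fun θ => clip n M (x (s + θ))) (d s)) (C := C) hab ?_ ?_ hC0 ?_ ?_ hφ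
  · exact fun x hx => (h3.clip M).aestronglyMeasurable hd hx ha b
  · intro x hx s hs
    have hs0 := ha.trans hs.1.le
    exact hC s hs0 hs.2 (fun θ => x (s + θ)) (by fun_prop) _ (hd.1 s hs0)
  · intro x y hx hy s hs hxy
    have hs0 := ha.trans hs.1.le
    refine h3.congr hs0 ?_ (fun θ hθ => ?_) (hd.1 s hs0)
    · exact (continuous_clip.comp (hy.comp (continuous_const_add s))).continuousOn
    · rw [hxy _ (by linarith [hθ.2])]
  · obtain ⟨A, hA, hlim⟩ := (h3.clip M).tendsto_of_uniform hd
    have hfin := finite_inter_Icc_of_locallyFinite hA a b ha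
    rw [ae_restrict_iff' measurableSet_Ioc]
    filter_upwards [(measure_eq_zero_iff_ae_notMem.1 (hfin.measure_zero volume))] with s hs hsab
    exact hlim s (ha.trans hsab.1.le) fun h => hs ⟨h, hsab.1.le, hsab.2⟩

end Truncation

/-! ### Solutions on compact intervals -/

/-- A continuous curve satisfying the integral equation on `[a, b]`. -/
def SolOn (n l : ℕ) (f : ℝ → (ℝ → Euc n) → Euc l → Euc n) (d : ℝ → Euc l) (a b : ℝ)
    (x : ℝ → Euc n) : Prop :=
  Continuous x ∧ ∀ t ∈ Icc a b, x t = x a + ∫ s in a..t, f s (fun θ => x (s + θ)) (d s)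

section SolOn

variable {n l : ℕ} {r : ℝ} {D : Set (Euc l)} {f : ℝ → (ℝ → Euc n) → Euc l → Euc n}
  {d : ℝ → Euc l} {a b : ℝ} {x y : ℝ → Euc n}

theorem SolOn.mono_right (hx : SolOn n l f d a b x) {c : ℝ} (hc : c ≤ b) : SolOn n l f d a c x :=
  ⟨hx.1, fun t ht => hx.2 t ⟨ht.1, ht.2.trans hc⟩⟩

theorem SolOn.sub_eq (h2 : H2 n l r D f) (h3 : H3 n l r D f) (hd : MD l D d) (ha : 0 ≤ a)
    (hx : SolOn n l f d a b x) {s t : ℝ} (hs : s ∈ Icc a b) (ht : t ∈ Icc a b) :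
    x t - x s = ∫ u in s..t, f u (fun θ => x (u + θ)) (d u) := by
  rw [hx.2 t ht, hx.2 s hs, add_sub_add_left_eq_sub]
  exact intervalIntegral.integral_interval_sub_left
    (h3.intervalIntegrable h2 hd hx.1 ha (ha.trans ht.1))
    (h3.intervalIntegrable h2 hd hx.1 ha (ha.trans hs.1))

theorem SolOn.mono_left (h2 : H2 n l r D f) (h3 : H3 n l r D f) (hd : MD l D d) (ha : 0 ≤ a)
    (hx : SolOn n l f d a b x) {c : ℝ} (hc : a ≤ c) : SolOn n l f d c b x := by
  refine ⟨hx.1, fun t ht => ?_⟩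
  rw [← hx.sub_eq h2 h3 hd ha ⟨hc, ht.1.trans ht.2⟩ ⟨hc.trans ht.1, ht.2⟩]
  abel

theorem SolOn.congr_integrand (hx : Continuous x) {g : ℝ → Euc n}
    (hxg : ∀ t ∈ Icc a b, x t = x a + ∫ s in a..t, g s)
    (hg : ∀ s ∈ Ioc a b, g s = f s (fun θ => x (s + θ)) (d s)) : SolOn n l f d a b x := by
  refine ⟨hx, fun t ht => ?_⟩
  rw [hxg t ht]
  congr 1
  refine intervalIntegral.integral_congr_ae (Eventually.of_forall fun s hs => ?_)
  rw [uIoc_of_le ht.1] at hs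
  exact hg s ⟨hs.1, hs.2.trans ht.2⟩

/-- A solution of the truncated equation which stays below the truncation level is a solution. -/
theorem SolOn.of_truncated (h3 : H3 n l r D f) (hd : MD l D d) (ha : 0 ≤ a) (hx : Continuous x)
    {M : ℝ} (hxM : ∀ t ∈ Icc (a - r) b, ‖x t‖ ≤ M)
    (heq : ∀ t ∈ Icc a b, x t = x a + ∫ s in a..t, f s (fun θ => clip n M (x (s + θ))) (d s)) :
    SolOn n l f d a b x := by
  refine SolOn.congr_integrand hx heq fun s hs => ?_
  have hs0 := ha.trans hs.1.le
  refine h3.congr hs0 (by fun_prop) (fun θ hθ => ?_) (hd.1 s hs0)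
  exact clip_of_norm_le (hxM _ ⟨by linarith [hs.1, hθ.1], by linarith [hs.2, hθ.2]⟩)

theorem SolOn.hasDerivAt (h2 : H2 n l r D f) (h3 : H3 n l r D f) (hd : MD l D d) (ha : 0 ≤ a)
    (hx : SolOn n l f d a b x) {t : ℝ} (ht : t ∈ Ioo a b)
    (hcont : ContinuousAt (fun s => f s (fun θ => x (s + θ)) (d s)) t) :
    HasDerivAt x (f t (fun θ => x (t + θ)) (d t)) t := by
  have h := (intervalIntegral.integral_hasDerivAt_right
    (h3.intervalIntegrable h2 hd hx.1 ha (ha.trans ht.1.le))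
    ⟨Ioc a b, Ioc_mem_nhds ht.1 ht.2, h3.aestronglyMeasurable hd hx.1 ha b⟩ hcont).const_add (x a)
  refine h.congr_of_eventuallyEq ?_
  filter_upwards [Icc_mem_nhds ht.1 ht.2] with s hs using hx.2 s hs

theorem SolOn.energy_identity (h2 : H2 n l r D f) (h3 : H3 n l r D f) (hd : MD l D d) (ha : 0 ≤ a)
    (hx : SolOn n l f d a b x) (hy : SolOn n l f d a b y) {t : ℝ} (ht : t ∈ Icc a b) :
    IntervalIntegrable (fun s => 2 * ⟪x s - y s,
      f s (fun θ => x (s + θ)) (d s) - f s (fun θ => y (s + θ)) (d s)⟫) volume a t ∧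
    ∫ s in a..t, 2 * ⟪x s - y s,
      f s (fun θ => x (s + θ)) (d s) - f s (fun θ => y (s + θ)) (d s)⟫ =
      ‖x t - y t‖ ^ 2 - ‖x a - y a‖ ^ 2 := by
  obtain ⟨A, hA, hcont⟩ := h3.exists_continuousAt hd
  have hF := (h3.intervalIntegrable h2 hd hx.1 ha (ha.trans ht.1)).sub
    (h3.intervalIntegrable h2 hd hy.1 ha (ha.trans ht.1))
  have hz : Continuous fun s => x s - y s := hx.1.sub hy.1
  have hintegrable : IntervalIntegrable (fun s => 2 * ⟪x s - y s,
      f s (fun θ => x (s + θ)) (d s) - f s (fun θ => y (s + θ)) (d s)⟫) volume a t := by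
    obtain ⟨K, hK0, hK⟩ := exists_bound_of_continuous hz a t
    refine (hF.norm.const_mul (2 * K)).mono_fun' ?_ ?_
    · exact (hz.aestronglyMeasurable.inner (𝕜 := ℝ) hF.def'.aestronglyMeasurable).const_mul 2
    · filter_upwards [ae_restrict_mem measurableSet_uIoc] with s hs
      rw [uIoc_of_le ht.1] at hs
      rw [norm_mul, Real.norm_of_nonneg zero_le_two, mul_assoc]
      gcongr
      refine (norm_inner_le_norm _ _).trans ?_
      gcongr
      exact hK s ⟨hs.1.le, hs.2⟩
  refine ⟨hintegrable, ?_⟩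
  refine integral_eq_of_hasDerivAt_off_countable_of_le (fun s => ‖x s - y s‖ ^ 2) _ ht.1
    (finite_inter_Icc_of_locallyFinite hA a b ha).countable (hz.norm.pow 2).continuousOn
    (fun s hs => ?_) hintegrable
  have hs' : s ∈ Ioo a b := ⟨hs.1.1, hs.1.2.trans_le ht.2⟩
  have hsA : s ∉ A := fun h => hs.2 ⟨h, hs'.1.le, hs'.2.le⟩
  have hs0 : 0 < s := ha.trans_lt hs'.1
  exact ((hx.hasDerivAt h2 h3 hd ha hs' (hcont x hx.1 s hs0 hsA)).sub
    (hy.hasDerivAt h2 h3 hd ha hs' (hcont y hy.1 s hs0 hsA))).norm_sq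

/-- Continuous dependence on initial histories, from the one-sided Lipschitz estimate. -/
theorem exists_gronwall_constant (hr : 0 ≤ r) (h1 : H1 n l r D f) (h2 : H2 n l r D f)
    (h3 : H3 n l r D f) (T : ℝ) {M : ℝ} (hM : 0 ≤ M) :
    ∃ L, 0 ≤ L ∧ ∀ d, MD l D d → ∀ a b x y, 0 ≤ a → a ≤ b → b ≤ T →
      SolOn n l f d a b x → SolOn n l f d a b y →
      (∀ t ∈ Icc (a - r) b, ‖x t‖ ≤ M) → (∀ t ∈ Icc (a - r) b, ‖y t‖ ≤ M) →
      ∀ m, 0 ≤ m → (∀ t ∈ Icc (a - r) a, ‖x t - y t‖ ≤ m) →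
      ∀ t ∈ Icc a b, ‖x t - y t‖ ≤ m * Real.exp (L * (t - a)) := by
  obtain ⟨Lf, -, hLmono, hLmono', hLnn, hL⟩ := h1
  rcases lt_or_ge T 0 with hT | hT
  · exact ⟨0, le_rfl, fun d _ a b x y ha hab hbT => absurd (ha.trans (hab.trans hbT)) (not_le.2 hT)⟩
  refine ⟨Lf T (M + M), hLnn _ _ hT (by positivity), ?_⟩
  intro d hd a b x y ha hab hbT hx hy hxM hyM m hm hstart
  set L := Lf T (M + M) with hLdef
  have hL0 : 0 ≤ L := hLnn _ _ hT (by positivity)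
  have key : ∀ ε > 0, ∀ t ∈ Icc a b,
      ‖x t - y t‖ ^ 2 ≤ (m + ε) ^ 2 * Real.exp (2 * L * (t - a)) := by
    intro ε hε
    have hBcont : Continuous fun t => (m + ε) ^ 2 * Real.exp (2 * L * (t - a)) := by fun_prop
    have strict : ∀ t ∈ Icc a b,
        (∀ s ∈ Ico a t, ‖x s - y s‖ ^ 2 ≤ (m + ε) ^ 2 * Real.exp (2 * L * (s - a))) →
        ‖x t - y t‖ ^ 2 < (m + ε) ^ 2 * Real.exp (2 * L * (t - a)) := by
      intro t ht hlt
      obtain ⟨hintegrable, hen⟩ := hx.energy_identity h2 h3 hd ha hy ht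
      have hB : ∫ s in a..t, (m + ε) ^ 2 * (Real.exp (2 * L * (s - a)) * (2 * L)) =
          (m + ε) ^ 2 * Real.exp (2 * L * (t - a)) - (m + ε) ^ 2 := by
        rw [intervalIntegral.integral_eq_sub_of_hasDerivAt
          (f := fun s => (m + ε) ^ 2 * Real.exp (2 * L * (s - a)))]
        · simp
        · intro s _
          have : HasDerivAt (fun s : ℝ => 2 * L * (s - a)) (2 * L) s := by
            simpa using ((hasDerivAt_id s).sub_const a).const_mul (2 * L)
          exact this.exp.const_mul _
        · exact Continuous.intervalIntegrable (by fun_prop) _ _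
      have hmono := intervalIntegral.integral_mono_on_of_le_Ioo ht.1 hintegrable
        (Continuous.intervalIntegrable (show Continuous fun s =>
          (m + ε) ^ 2 * (Real.exp (2 * L * (s - a)) * (2 * L)) by fun_prop) _ _) (fun s hs => by
        have hs0 : 0 ≤ s := ha.trans hs.1.le
        have hsb : s ≤ b := hs.2.le.trans ht.2
        have hxc : Continuous fun θ => x (s + θ) := by have := hx.1; fun_prop
        have hyc : Continuous fun θ => y (s + θ) := by have := hy.1; fun_prop
        have hone := hL s (fun θ => x (s + θ)) (fun θ => y (s + θ)) (d s) hs0 hxc.continuousOn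
          hyc.continuousOn (hd.1 s hs0)
        simp only [add_zero] at hone
        have hNx : histNorm n r (fun θ => x (s + θ)) ≤ M := histNorm_le hM fun θ hθ =>
          hxM _ ⟨by linarith [hs.1, hθ.1], by linarith [hθ.2]⟩
        have hNy : histNorm n r (fun θ => y (s + θ)) ≤ M := histNorm_le hM fun θ hθ =>
          hyM _ ⟨by linarith [hs.1, hθ.1], by linarith [hθ.2]⟩
        have hLs : Lf s (histNorm n r (fun θ => x (s + θ)) + histNorm n r (fun θ => y (s + θ)))
            ≤ L :=
          (hLmono s hs0 (add_nonneg histNorm_nonneg histNorm_nonneg) (add_nonneg hM hM)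
            (add_le_add hNx hNy)).trans
            (hLmono' _ (add_nonneg hM hM) hs0 hT (hsb.trans hbT))
        have hexp1 : 1 ≤ Real.exp (2 * L * (s - a)) :=
          Real.one_le_exp (mul_nonneg (by positivity) (by linarith [hs.1]))
        have hN : histNorm n r ((fun θ => x (s + θ)) - fun θ => y (s + θ)) ≤
            √((m + ε) ^ 2 * Real.exp (2 * L * (s - a))) := by
          refine histNorm_le (Real.sqrt_nonneg _) fun θ hθ => Real.le_sqrt_of_sq_le ?_
          simp only [Pi.sub_apply]
          rcases lt_or_ge (s + θ) a with h | h
          · have h' := hstart (s + θ) ⟨by linarith [hs.1, hθ.1], h.le⟩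
            calc ‖x (s + θ) - y (s + θ)‖ ^ 2 ≤ (m + ε) ^ 2 :=
                  pow_le_pow_left₀ (norm_nonneg _) (by linarith) 2
              _ ≤ _ := le_mul_of_one_le_right (by positivity) hexp1
          · refine (hlt (s + θ) ⟨h, by linarith [hs.2, hθ.2]⟩).trans ?_
            gcongr
            linarith [hθ.2]
        have hN2 : histNorm n r ((fun θ => x (s + θ)) - fun θ => y (s + θ)) ^ 2 ≤
            (m + ε) ^ 2 * Real.exp (2 * L * (s - a)) := by
          calc _ ≤ √((m + ε) ^ 2 * Real.exp (2 * L * (s - a))) ^ 2 :=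
                pow_le_pow_left₀ histNorm_nonneg hN 2
            _ = _ := Real.sq_sqrt (by positivity)
        have : Lf s (histNorm n r (fun θ => x (s + θ)) + histNorm n r (fun θ => y (s + θ))) *
            histNorm n r ((fun θ => x (s + θ)) - fun θ => y (s + θ)) ^ 2 ≤
            L * ((m + ε) ^ 2 * Real.exp (2 * L * (s - a))) :=
          mul_le_mul hLs hN2 (by positivity) hL0
        show 2 * _ ≤ _
        nlinarith [hone, this])
      rw [hen, hB] at hmono
      have h0 : ‖x a - y a‖ ^ 2 ≤ m ^ 2 :=
        pow_le_pow_left₀ (norm_nonneg _) (hstart a ⟨by linarith, le_rfl⟩) 2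
      nlinarith [h0, hmono, mul_pos hε hε, mul_nonneg hm hε.le]
    refine real_induction (fun t ht h => (strict t ht h).le) fun t ht h => ?_
    have hst := strict t ⟨ht.1, ht.2.le⟩ fun s hs => h s ⟨hs.1, hs.2.le⟩
    have hcont : Continuous fun s => ‖x s - y s‖ ^ 2 := by
      have := hx.1; have := hy.1; fun_prop
    obtain ⟨δ, hδ, hball⟩ := Metric.eventually_nhds_iff.1
      (hcont.continuousAt.eventually_lt hBcont.continuousAt hst)
    refine ⟨δ, hδ, fun s hs => (hball ?_).le⟩
    rw [Real.dist_eq, abs_of_pos (by linarith [hs.1])]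
    linarith [hs.2]
  intro t ht
  have hE : 0 < Real.exp (L * (t - a)) := Real.exp_pos _
  refine le_of_forall_pos_le_add fun ε hε => ?_
  have hk := key (ε / Real.exp (L * (t - a))) (by positivity) t ht
  have heq : (m + ε / Real.exp (L * (t - a))) ^ 2 * Real.exp (2 * L * (t - a)) =
      (m * Real.exp (L * (t - a)) + ε) ^ 2 := by
    have : Real.exp (2 * L * (t - a)) = Real.exp (L * (t - a)) ^ 2 := by
      rw [← Real.exp_nat_mul]; congr 1; push_cast; ring
    rw [this]
    field_simp
  rw [heq] at hk
  exact (pow_le_pow_iff_left₀ (norm_nonneg _) (by positivity) two_ne_zero).1 hk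

end SolOn

/-! ### Upper right Dini derivatives -/

/-- The upper right Dini derivative of `g` at `t` is at most `c`. -/
def RightSlopeLE (g : ℝ → ℝ) (t c : ℝ) : Prop :=
  ∀ ε > 0, ∃ δ > 0, ∀ h, 0 < h → h < δ → g (t + h) ≤ g t + h * (c + ε)

theorem HasDerivAt.rightSlopeLE {g : ℝ → ℝ} {t c : ℝ} (hg : HasDerivAt g c t) :
    RightSlopeLE g t c := by
  intro ε hε
  have := (hasDerivAt_iff_isLittleO_nhds_zero.1 hg).bound hε
  obtain ⟨δ, hδ, h⟩ := Metric.eventually_nhds_iff.1 this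
  refine ⟨δ, hδ, fun s hs hsδ => ?_⟩
  have hk := h (y := s) (by rwa [Real.dist_eq, sub_zero, abs_of_pos hs])
  rw [Real.norm_eq_abs, Real.norm_eq_abs, abs_of_pos hs, smul_eq_mul] at hk
  linarith [(abs_le.1 hk).2]

theorem RightSlopeLE.mono {g : ℝ → ℝ} {t c c' : ℝ} (hg : RightSlopeLE g t c) (hc : c ≤ c') :
    RightSlopeLE g t c' := by
  intro ε hε
  obtain ⟨δ, hδ, h⟩ := hg ε hε
  refine ⟨δ, hδ, fun s hs hsδ => (h s hs hsδ).trans ?_⟩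
  gcongr

theorem RightSlopeLE.add {g k : ℝ → ℝ} {t c c' : ℝ} (hg : RightSlopeLE g t c)
    (hk : RightSlopeLE k t c') : RightSlopeLE (fun s => g s + k s) t (c + c') := by
  intro ε hε
  obtain ⟨δ₁, hδ₁, h₁⟩ := hg (ε / 2) (half_pos hε)
  obtain ⟨δ₂, hδ₂, h₂⟩ := hk (ε / 2) (half_pos hε)
  refine ⟨min δ₁ δ₂, by positivity, fun s hs hsδ => ?_⟩
  have e1 := h₁ s hs (hsδ.trans_le (min_le_left _ _))
  have e2 := h₂ s hs (hsδ.trans_le (min_le_right _ _))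
  simp only
  linarith

/-- `g` does not jump upwards immediately after `t`. -/
def RightUSC (g : ℝ → ℝ) (t : ℝ) : Prop :=
  ∀ ε > 0, ∃ δ > 0, ∀ h, 0 < h → h < δ → g (t + h) ≤ g t + ε

/-- `g` does not jump upwards at `t` when coming from the left, inside `[a, ∞)`. -/
def LeftLSC (g : ℝ → ℝ) (a t : ℝ) : Prop :=
  ∀ ε > 0, ∃ δ > 0, ∀ s, a ≤ s → t - δ < s → s < t → g t ≤ g s + ε

theorem RightUSC.add_continuous {g k : ℝ → ℝ} {t : ℝ} (hg : RightUSC g t)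
    (hk : ContinuousAt k t) : RightUSC (fun s => g s + k s) t := by
  intro ε hε
  obtain ⟨δ₁, hδ₁, h₁⟩ := hg (ε / 2) (half_pos hε)
  obtain ⟨δ₂, hδ₂, h₂⟩ := Metric.continuousAt_iff.1 hk (ε / 2) (half_pos hε)
  refine ⟨min δ₁ δ₂, by positivity, fun s hs hsδ => ?_⟩
  have e1 := h₁ s hs (hsδ.trans_le (min_le_left _ _))
  have e2 := h₂ (x := t + s) (by
    rw [Real.dist_eq, add_sub_cancel_left, abs_of_pos hs]
    exact hsδ.trans_le (min_le_right _ _))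
  rw [Real.dist_eq, abs_lt] at e2
  simp only
  linarith

theorem LeftLSC.add_continuous {g k : ℝ → ℝ} {a t : ℝ} (hg : LeftLSC g a t)
    (hk : ContinuousAt k t) : LeftLSC (fun s => g s + k s) a t := by
  intro ε hε
  obtain ⟨δ₁, hδ₁, h₁⟩ := hg (ε / 2) (half_pos hε)
  obtain ⟨δ₂, hδ₂, h₂⟩ := Metric.continuousAt_iff.1 hk (ε / 2) (half_pos hε)
  refine ⟨min δ₁ δ₂, by positivity, fun s has hs hst => ?_⟩
  have e1 := h₁ s has (by linarith [min_le_left δ₁ δ₂]) hst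
  have e2 := h₂ (x := s) (by
    rw [Real.dist_eq, abs_sub_comm, abs_of_pos (by linarith)]
    linarith [min_le_right δ₁ δ₂])
  rw [Real.dist_eq, abs_lt] at e2
  simp only
  linarith

theorem RightUSC.max {g k : ℝ → ℝ} {t : ℝ} (hg : RightUSC g t)
    (hk : RightUSC k t) : RightUSC (fun s => max (g s) (k s)) t := by
  intro ε hε
  obtain ⟨δ₁, hδ₁, h₁⟩ := hg ε hε
  obtain ⟨δ₂, hδ₂, h₂⟩ := hk ε hε
  refine ⟨min δ₁ δ₂, by positivity, fun s hs hsδ => max_le ?_ ?_⟩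
  · exact (h₁ s hs (hsδ.trans_le (min_le_left _ _))).trans
      (add_le_add_left (le_max_left _ _) _)
  · exact (h₂ s hs (hsδ.trans_le (min_le_right _ _))).trans
      (add_le_add_left (le_max_right _ _) _)

theorem LeftLSC.max {g k : ℝ → ℝ} {a t : ℝ} (hg : LeftLSC g a t)
    (hk : LeftLSC k a t) : LeftLSC (fun s => max (g s) (k s)) a t := by
  intro ε hε
  obtain ⟨δ₁, hδ₁, h₁⟩ := hg ε hε
  obtain ⟨δ₂, hδ₂, h₂⟩ := hk ε hε
  refine ⟨min δ₁ δ₂, by positivity, fun s has hs hst => max_le ?_ ?_⟩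
  · exact (h₁ s has (by linarith [min_le_left δ₁ δ₂]) hst).trans
      (add_le_add_left (le_max_left _ _) _)
  · exact (h₂ s has (by linarith [min_le_right δ₁ δ₂]) hst).trans
      (add_le_add_left (le_max_right _ _) _)

theorem ContinuousAt.rightUSC {k : ℝ → ℝ} {t : ℝ} (hk : ContinuousAt k t) : RightUSC k t := by
  have h0 : RightUSC (fun _ => (0 : ℝ)) t := fun ε hε => ⟨1, one_pos, fun _ _ _ => by linarith⟩
  simpa using h0.add_continuous hk

theorem ContinuousAt.leftLSC {k : ℝ → ℝ} {t : ℝ} (hk : ContinuousAt k t) (a : ℝ) :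
    LeftLSC k a t := by
  have h0 : LeftLSC (fun _ => (0 : ℝ)) a t := fun ε hε => ⟨1, one_pos, fun _ _ _ _ => by linarith⟩
  simpa using h0.add_continuous hk

/-- A function without upward jumps whose upper right Dini derivative is nonpositive outside a
finite set does not increase. -/
theorem le_of_rightSlopeLE {g : ℝ → ℝ} {a b : ℝ} (hab : a ≤ b) {A : Set ℝ}
    (hA : (A ∩ Icc a b).Finite) (hlsc : ∀ t ∈ Ioc a b, LeftLSC g a t)
    (hslope : ∀ t ∈ Ico a b, t ∉ A → RightSlopeLE g t 0)
    (hjump : ∀ t ∈ Ico a b, t ∈ A → RightUSC g t) : g b ≤ g a := by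
  set N : ℝ → ℝ := fun t => (((A ∩ Icc a b) ∩ Iio t).ncard : ℝ) with hN
  have hNmono : ∀ s t, s ≤ t → N s ≤ N t := by
    intro s t hst
    simp only [hN, Nat.cast_le]
    exact ncard_le_ncard (inter_subset_inter_right _ (Iio_subset_Iio hst))
      (hA.subset inter_subset_left)
  have hNjump : ∀ s t, s < t → s ∈ A → s ∈ Icc a b → N s + 1 ≤ N t := by
    intro s t hst hsA hsab
    have : ((A ∩ Icc a b) ∩ Iio s).ncard < ((A ∩ Icc a b) ∩ Iio t).ncard := by
      refine ncard_lt_ncard ?_ (hA.subset inter_subset_left)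
      refine (ssubset_iff_of_subset (inter_subset_inter_right _ (Iio_subset_Iio hst.le))).2 ?_
      exact ⟨s, ⟨⟨hsA, hsab⟩, hst⟩, fun h => lt_irrefl s h.2⟩
    simp only [hN]
    exact_mod_cast this
  have hNnn : ∀ t, 0 ≤ N t := fun t => Nat.cast_nonneg _
  have key : ∀ ε > 0, ∀ t ∈ Icc a b, g t ≤ g a + ε * (t - a) + ε * N t := by
    intro ε hε
    refine real_induction (fun t ht h => ?_) fun t ht h => ?_
    · rcases ht.1.eq_or_lt with rfl | hat
      · have := hNnn a
        have : 0 ≤ ε * N a := by positivity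
        linarith
      refine le_of_forall_pos_le_add fun η hη => ?_
      obtain ⟨δ, hδ, hs⟩ := hlsc t ⟨hat, ht.2⟩ η hη
      set s := max a (t - δ / 2) with hsdef
      have hst : s < t := max_lt hat (by linarith)
      have h1 := hs s (le_max_left _ _) (by linarith [le_max_right a (t - δ / 2)]) hst
      have h2 := h s ⟨le_max_left _ _, hst⟩
      have h3 := mul_le_mul_of_nonneg_left (hNmono s t hst.le) hε.le
      have h4 : ε * (s - a) ≤ ε * (t - a) := by gcongr
      linarith
    · have hgt := h t ⟨ht.1, le_rfl⟩
      by_cases htA : t ∈ A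
      · obtain ⟨δ, hδ, hs⟩ := hjump t ht htA ε hε
        refine ⟨δ, hδ, fun s hs' => ?_⟩
        have h1 := hs (s - t) (by linarith [hs'.1]) (by linarith [hs'.2])
        rw [add_sub_cancel] at h1
        have h2 := mul_le_mul_of_nonneg_left (hNjump t s hs'.1 htA ⟨ht.1, ht.2.le⟩) hε.le
        have h4 : ε * (t - a) ≤ ε * (s - a) := by gcongr; exact hs'.1.le
        linarith
      · obtain ⟨δ, hδ, hs⟩ := hslope t ht htA ε hε
        refine ⟨δ, hδ, fun s hs' => ?_⟩
        have h1 := hs (s - t) (by linarith [hs'.1]) (by linarith [hs'.2])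
        rw [add_sub_cancel] at h1
        have h2 := mul_le_mul_of_nonneg_left (hNmono t s hs'.1.le) hε.le
        linarith
  refine le_of_forall_pos_le_add fun η hη => ?_
  have hpos : 0 < (b - a) + N b + 1 := by linarith [hNnn b]
  have := key (η / ((b - a) + N b + 1)) (by positivity) b ⟨hab, le_rfl⟩
  have h2 : η / ((b - a) + N b + 1) * (b - a) + η / ((b - a) + N b + 1) * N b ≤ η := by
    rw [← mul_add, div_mul_eq_mul_div, div_le_iff₀ hpos]
    nlinarith
  linarith

/-- A Gronwall estimate for upper right Dini derivatives. -/
theorem growth_of_rightSlopeLE {v : ℝ → ℝ} {a b : ℝ} (hab : a ≤ b) {A : Set ℝ}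
    (hA : (A ∩ Icc a b).Finite) {K c : ℝ} (hK : 0 ≤ K) (hc : 0 ≤ c)
    (hv : ∀ t ∈ Icc a b, 0 ≤ v t) (hlsc : ∀ t ∈ Ioc a b, LeftLSC v a t)
    (hslope : ∀ t ∈ Ico a b, t ∉ A → RightSlopeLE v t (K * v t + c))
    (hjump : ∀ t ∈ Ico a b, t ∈ A → RightUSC v t) :
    v b ≤ Real.exp (K * (b - a)) * (v a + c * (b - a)) := by
  set g : ℝ → ℝ := fun t => Real.exp (-(K * (t - a))) * v t - c * (t - a) with hg
  have hexp_le : ∀ t, a ≤ t → Real.exp (-(K * (t - a))) ≤ 1 := fun t ht =>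
    Real.exp_le_one_iff.2 (by nlinarith)
  have hmono : ∀ s t, s ≤ t → Real.exp (-(K * (t - a))) ≤ Real.exp (-(K * (s - a))) :=
    fun s t hst => Real.exp_le_exp.2 (by nlinarith)
  have hmain : g b ≤ g a := by
    refine le_of_rightSlopeLE hab hA (fun t ht ε hε => ?_) (fun t ht htA ε hε => ?_)
      (fun t ht htA ε hε => ?_)
    · obtain ⟨δ, hδ, h⟩ := hlsc t ht (ε / 2) (half_pos hε)
      refine ⟨min δ (ε / (2 * (c + 1))), by positivity, fun s has hs hst => ?_⟩
      have h1 := h s has (by linarith [min_le_left δ (ε / (2 * (c + 1)))]) hst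
      have h2 : t - s < ε / (2 * (c + 1)) := by linarith [min_le_right δ (ε / (2 * (c + 1)))]
      rw [lt_div_iff₀ (by positivity)] at h2
      have hvs := hv s ⟨has, by linarith [ht.2]⟩
      have e1 := hmono s t hst.le
      have e2 := hexp_le t ht.1.le
      have e3 := Real.exp_pos (-(K * (t - a)))
      have : Real.exp (-(K * (t - a))) * v t ≤ Real.exp (-(K * (s - a))) * v s + ε / 2 := by
        calc _ ≤ Real.exp (-(K * (t - a))) * (v s + ε / 2) := by gcongr
          _ = Real.exp (-(K * (t - a))) * v s + Real.exp (-(K * (t - a))) * (ε / 2) := by ring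
          _ ≤ Real.exp (-(K * (s - a))) * v s + 1 * (ε / 2) := by gcongr
          _ = _ := by ring
      simp only [hg]
      nlinarith
    · obtain ⟨δ, hδ, h⟩ := hslope t ht htA ε hε
      refine ⟨δ, hδ, fun s hs hsδ => ?_⟩
      have h1 := h s hs hsδ
      have hvt := hv t ⟨ht.1, ht.2.le⟩
      have hsplit : Real.exp (-(K * (t + s - a))) =
          Real.exp (-(K * (t - a))) * Real.exp (-(K * s)) := by
        rw [← Real.exp_add]; congr 1; ring
      have hk1 : Real.exp (-(K * s)) * (1 + K * s) ≤ 1 := by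
        have := Real.add_one_le_exp (K * s)
        calc Real.exp (-(K * s)) * (1 + K * s) ≤ Real.exp (-(K * s)) * Real.exp (K * s) := by
              gcongr; linarith
          _ = 1 := by rw [← Real.exp_add]; simp
      have hk2 : Real.exp (-(K * (t + s - a))) ≤ 1 := hexp_le _ (by linarith [ht.1])
      have : Real.exp (-(K * (t + s - a))) * v (t + s) ≤
          Real.exp (-(K * (t - a))) * v t + s * (c + ε) := by
        calc _ ≤ Real.exp (-(K * (t + s - a))) * (v t + s * (K * v t + c + ε)) := by gcongr
          _ = Real.exp (-(K * (t - a))) * (Real.exp (-(K * s)) * (1 + K * s)) * v t +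
              Real.exp (-(K * (t + s - a))) * (s * (c + ε)) := by rw [hsplit]; ring
          _ ≤ Real.exp (-(K * (t - a))) * 1 * v t + 1 * (s * (c + ε)) := by gcongr
          _ = _ := by ring
      simp only [hg]
      nlinarith
    · obtain ⟨δ, hδ, h⟩ := hjump t ht htA ε hε
      refine ⟨δ, hδ, fun s hs hsδ => ?_⟩
      have h1 := h s hs hsδ
      have hvt := hv t ⟨ht.1, ht.2.le⟩
      have hk2 : Real.exp (-(K * (t + s - a))) ≤ 1 := hexp_le _ (by linarith [ht.1])
      have hk3 := hmono t (t + s) (by linarith)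
      have : Real.exp (-(K * (t + s - a))) * v (t + s) ≤
          Real.exp (-(K * (t - a))) * v t + ε := by
        calc _ ≤ Real.exp (-(K * (t + s - a))) * (v t + ε) := by gcongr
          _ = Real.exp (-(K * (t + s - a))) * v t + Real.exp (-(K * (t + s - a))) * ε := by ring
          _ ≤ Real.exp (-(K * (t - a))) * v t + 1 * ε := by gcongr
          _ = _ := by ring
      simp only [hg]
      nlinarith
  simp only [hg, sub_self, mul_zero, neg_zero, Real.exp_zero, one_mul, sub_zero] at hmain
  have hE := Real.exp_pos (K * (b - a))
  have hprod : Real.exp (K * (b - a)) * Real.exp (-(K * (b - a))) = 1 := by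
    rw [← Real.exp_add]; simp
  calc v b = Real.exp (K * (b - a)) * (Real.exp (-(K * (b - a))) * v b) := by
        rw [← mul_assoc, hprod, one_mul]
    _ ≤ _ := by gcongr; linarith

/-! ### Functionals along solutions -/

/-- Lower semicontinuity of a functional on `[0,∞) × C([-q,0];ℝⁿ)`. -/
def HistLSC (n : ℕ) (q : ℝ) (V : ℝ → (ℝ → Euc n) → ℝ) : Prop :=
  ∀ t x, 0 ≤ t → ContinuousOn x (Icc (-q) 0) → ∀ ε > 0, ∃ δ > 0,
    ∀ t' x', 0 ≤ t' → ContinuousOn x' (Icc (-q) 0) →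
      |t' - t| + histNorm n q (x' - x) < δ → V t x - ε < V t' x'

section Functional

variable {n : ℕ} {q : ℝ} {V : ℝ → (ℝ → Euc n) → ℝ}

theorem HistLSC.le_of_eqOn (hV : HistLSC n q V) {t : ℝ} (ht : 0 ≤ t) {x y : ℝ → Euc n}
    (hx : ContinuousOn x (Icc (-q) 0)) (hxy : EqOn x y (Icc (-q) 0)) : V t x ≤ V t y := by
  refine le_of_forall_pos_le_add fun ε hε => ?_
  obtain ⟨δ, hδ, h⟩ := hV t x ht hx ε hε
  have h0 : histNorm n q (y - x) ≤ 0 := histNorm_le le_rfl fun θ hθ => by simp [hxy hθ]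
  have := h t y ht (hx.congr hxy.symm) (by rw [sub_self, abs_zero]; linarith)
  linarith

theorem HistLSC.leftLSC (hV : HistLSC n q V) {x : ℝ → Euc n} (hx : Continuous x) {a t : ℝ}
    (ha : 0 ≤ a) (hat : a ≤ t) : LeftLSC (fun s => V s fun θ => x (s + θ)) a t := by
  intro ε hε
  obtain ⟨δ, hδ, h⟩ := hV t (fun θ => x (t + θ)) (ha.trans hat) (by fun_prop) ε hε
  obtain ⟨δ', hδ', h'⟩ := exists_histNorm_shift_lt hx q t (half_pos hδ)
  refine ⟨min δ' (δ / 2), by positivity, fun s has hs hst => ?_⟩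
  have habs : |s - t| < min δ' (δ / 2) := by rw [abs_sub_comm, abs_of_pos] <;> linarith
  have h1 := h' s (habs.trans_le (min_le_left _ _))
  have h2 := habs.trans_le (min_le_right _ _)
  have := h s (fun θ => x (s + θ)) (ha.trans has) (by fun_prop) (by linarith)
  simp only
  linarith

theorem exists_forall_le_of_Vdot_le {t : ℝ} {x : ℝ → Euc n} {w : Euc n} {c : ℝ}
    (hc : Vdot n q V t x w ≤ (c : EReal)) {ε : ℝ} (hε : 0 < ε) :
    ∃ δ > 0, ∀ h y, 0 < h → h < δ → ContinuousOn y (Icc (-q) 0) → histNorm n q y < δ →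
      V (t + h) (fun θ => Eop n x h w θ + h • y θ) ≤ V t x + h * (c + ε) := by
  have hlt : Vdot n q V t x w < ((c + ε : ℝ) : EReal) :=
    hc.trans_lt (EReal.coe_lt_coe_iff.2 (by linarith))
  obtain ⟨δ, hδ⟩ := iInf_lt_iff.1 hlt
  refine ⟨δ, δ.2, fun h y hh hhδ hy hyδ => ?_⟩
  have h1 := (le_iSup (fun p : {p : ℝ × (ℝ → Euc n) //
      0 < p.1 ∧ p.1 < (δ : ℝ) ∧ ContinuousOn p.2 (Icc (-q) 0) ∧ histNorm n q p.2 < (δ : ℝ)} =>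
    (((V (t + p.1.1) (fun θ => Eop n x p.1.1 w θ + p.1.1 • p.1.2 θ) - V t x) / p.1.1 : ℝ) : EReal))
    ⟨(h, y), hh, hhδ, hy, hyδ⟩).trans hδ.le
  have h2 := EReal.coe_le_coe_iff.1 h1
  simp only at h2
  rw [div_le_iff₀ hh] at h2
  linarith

/-- The curve which follows `x` up to time `t` and then moves with constant velocity `w`. -/
def ray (x : ℝ → Euc n) (t : ℝ) (w : Euc n) (s : ℝ) : Euc n := x (min s t) + (max (s - t) 0) • w

theorem continuous_ray {x : ℝ → Euc n} (hx : Continuous x) (t : ℝ) (w : Euc n) :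
    Continuous (ray x t w) := by
  unfold ray
  fun_prop

theorem ray_of_le (x : ℝ → Euc n) {t s : ℝ} (w : Euc n) (hs : s ≤ t) : ray x t w s = x s := by
  simp [ray, min_eq_left hs, max_eq_right (sub_nonpos.2 hs)]

theorem ray_of_ge (x : ℝ → Euc n) {t s : ℝ} (w : Euc n) (hs : t ≤ s) :
    ray x t w s = x t + (s - t) • w := by
  simp [ray, min_eq_right hs, max_eq_left (sub_nonneg.2 hs)]

theorem Eop_eq_ray (x : ℝ → Euc n) (t h : ℝ) (w : Euc n) (θ : ℝ) :
    Eop n (fun θ => x (t + θ)) h w θ = ray x t w (t + h + θ) := by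
  unfold Eop
  split_ifs with hθ
  · rw [ray_of_ge x w (by linarith)]
    simp only [add_zero]
    congr 2
    ring
  · rw [ray_of_le x w (by linarith), add_assoc, add_comm h]

end Functional

section AlongSolutions

variable {n l : ℕ} {q r : ℝ} {V : ℝ → (ℝ → Euc n) → ℝ} {D : Set (Euc l)}
  {f : ℝ → (ℝ → Euc n) → Euc l → Euc n} {d : ℝ → Euc l} {a b : ℝ} {x : ℝ → Euc n}

theorem SolOn.rightSlopeLE (h2 : H2 n l r D f) (h3 : H3 n l r D f) (hd : MD l D d) (ha : 0 ≤ a)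
    (hx : SolOn n l f d a b x) {t : ℝ} (ht : t ∈ Ico a b)
    (hright : ∀ ε > 0, ∃ δ > 0, ∀ s ∈ Ico t (t + δ),
      ‖f s (fun θ => x (s + θ)) (d s) - f t (fun θ => x (t + θ)) (d t)‖ < ε) {c : ℝ}
    (hc : Vdot n q V t (fun θ => x (t + θ)) (f t (fun θ => x (t + θ)) (d t)) ≤ (c : EReal)) :
    RightSlopeLE (fun s => V s fun θ => x (s + θ)) t c := by
  intro ε hε
  set w := f t (fun θ => x (t + θ)) (d t) with hw
  obtain ⟨δ, hδ, hV⟩ := exists_forall_le_of_Vdot_le hc hε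
  obtain ⟨δ₁, hδ₁, hr⟩ := hright (δ / 2) (half_pos hδ)
  have hbt : 0 < b - t := sub_pos.2 ht.2
  refine ⟨min δ (min δ₁ (b - t)), by positivity, fun h hh hhδ => ?_⟩
  have e1 := hhδ.trans_le (min_le_left _ _)
  have e2 := hhδ.trans_le ((min_le_right _ _).trans (min_le_left _ _))
  have e3 := hhδ.trans_le ((min_le_right _ _).trans (min_le_right _ _))
  have hest : ∀ u ≤ t + h, ‖x u - ray x t w u‖ ≤ δ / 2 * h := by
    intro u hu
    rcases le_total u t with hut | hut
    · rw [ray_of_le x w hut, sub_self, norm_zero]; positivity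
    · rw [ray_of_ge x w hut]
      have hi := hx.sub_eq h2 h3 hd ha ⟨ht.1, ht.2.le⟩ (t := u) ⟨ht.1.trans hut, by linarith⟩
      have hintegrable : IntervalIntegrable (fun s => f s (fun θ => x (s + θ)) (d s)) volume t u :=
        h3.intervalIntegrable h2 hd hx.1 (ha.trans ht.1) (ha.trans (ht.1.trans hut))
      have : x u - (x t + (u - t) • w) =
          ∫ s in t..u, (f s (fun θ => x (s + θ)) (d s) - w) := by
        rw [intervalIntegral.integral_sub hintegrable intervalIntegrable_const, ← hi,
          intervalIntegral.integral_const]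
        abel
      rw [this]
      refine (intervalIntegral.norm_integral_le_of_norm_le_const (C := δ / 2) fun s hs => ?_).trans ?_
      · rw [uIoc_of_le hut] at hs
        exact (hr s ⟨hs.1.le, by linarith [hs.2]⟩).le
      · rw [abs_of_nonneg (by linarith)]
        gcongr
        linarith
  have hcy : Continuous fun θ => h⁻¹ • (x (t + h + θ) - ray x t w (t + h + θ)) := by
    have := continuous_ray hx.1 t w
    have := hx.1
    fun_prop
  have hfin := hV h (fun θ => h⁻¹ • (x (t + h + θ) - ray x t w (t + h + θ))) hh e1
    hcy.continuousOn ?_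
  · convert hfin using 3 with θ
    rw [Eop_eq_ray, smul_inv_smul₀ hh.ne']
    abel
  · refine lt_of_le_of_lt (histNorm_le (half_pos hδ).le fun θ hθ => ?_) (half_lt_self hδ)
    rw [norm_smul, norm_inv, Real.norm_eq_abs, abs_of_pos hh, inv_mul_le_iff₀ hh, mul_comm h]
    exact hest _ (by linarith [hθ.2])

theorem SolOn.exists_norm_sub_le (h2 : H2 n l r D f) (h3 : H3 n l r D f) (ha : 0 ≤ a)
    (T M : ℝ) (hM : 0 ≤ M) : ∃ C, 0 ≤ C ∧ ∀ d, MD l D d → ∀ x b, b ≤ T → SolOn n l f d a b x →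
      (∀ t ∈ Icc (a - r) b, ‖x t‖ ≤ M) →
      ∀ s ∈ Icc a b, ∀ t ∈ Icc s b, ‖x t - x s‖ ≤ C * (t - s) := by
  obtain ⟨C, hC⟩ := h2 T M
  refine ⟨max C 0, le_max_right _ _, fun d hd x b hb hx hxM s hs t ht => ?_⟩
  rw [hx.sub_eq h2 h3 hd ha hs ⟨hs.1.trans ht.1, ht.2⟩]
  refine (intervalIntegral.norm_integral_le_of_norm_le_const (C := max C 0) fun u hu => ?_).trans ?_
  · rw [uIoc_of_le ht.1] at hu
    have hau : a ≤ u := hs.1.trans hu.1.le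
    have := hx.1
    refine le_max_of_le_left (hC u _ _ (ha.trans hau) (hu.2.trans (ht.2.trans hb))
      (by fun_prop) (histNorm_le hM fun θ hθ => ?_) (hd.1 u (ha.trans hau)))
    exact hxM _ ⟨by linarith [hθ.1], by linarith [hθ.2, hu.2, ht.2]⟩
  · rw [abs_of_nonneg (by linarith [ht.1])]

/-- The derivative of `V` along the equation grows at most affinely in `V`, up to time `T`. -/
def GrowsAffinely (n l : ℕ) (q : ℝ) (D : Set (Euc l)) (f : ℝ → (ℝ → Euc n) → Euc l → Euc n)
    (V : ℝ → (ℝ → Euc n) → ℝ) (T K c : ℝ) : Prop :=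
  ∀ t x d, 0 ≤ t → t ≤ T → ContinuousOn x (Icc (-q) 0) → d ∈ D →
    Vdot n q V t x (f t x d) ≤ ((K * V t x + c : ℝ) : EReal)

theorem SolOn.rightUSC (hr : 0 ≤ r) (h1 : H1 n l r D f) (h2 : H2 n l r D f)
    (h3 : H3 n l r D f) (hVnn : ∀ t x, 0 ≤ t → ContinuousOn x (Icc (-q) 0) → 0 ≤ V t x)
    (hV : HistLSC n q V) {T K c : ℝ} (hK : 0 ≤ K) (hc : 0 ≤ c)
    (hgrow : GrowsAffinely n l q D f V T K c) (hd : MD l D d) (ha : 0 ≤ a) (hbT : b ≤ T)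
    (hx : SolOn n l f d a b x) {t : ℝ} (ht : t ∈ Ico a b) :
    RightUSC (fun s => V s fun θ => x (s + θ)) t := by
  have ht0 : 0 ≤ t := ha.trans ht.1
  obtain ⟨A, hA, hright⟩ := h3.exists_right
  obtain ⟨δA, hδA, hgap⟩ := exists_right_gap hA ht0
  obtain ⟨M, hM0, hM⟩ := exists_bound_of_continuous hx.1 (t - r) b
  set w := f t (fun θ => x (t + θ)) (d t) with hw
  have hxt : SolOn n l f d t b x := hx.mono_left h2 h3 hd ha ht.1
  obtain ⟨C₁, hC₁0, hC₁⟩ := SolOn.exists_norm_sub_le (a := t) h2 h3 ht0 b (M + 2) (by linarith)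
  obtain ⟨C₂, hC₂0, hC₂⟩ := h2.exists_clip_bound b (M + 2)
  obtain ⟨L, hL0, hL⟩ := exists_gronwall_constant hr h1 h2 h3 b (M := M + 2) (by linarith)
  obtain ⟨δV, hδV, hVd⟩ := exists_forall_le_of_Vdot_le
    (hgrow t (fun θ => x (t + θ)) (d t) ht0 (ht.2.le.trans hbT)
      (by have := hx.1; fun_prop) (hd.1 t ht0)) one_pos
  rw [← hw] at hVd
  set v : ℝ → ℝ := fun s => V s fun θ => x (s + θ) with hv
  have hbt : 0 < b - t := sub_pos.2 ht.2
  set δ₀ := min δA (min (b - t) (1 / (‖w‖ + C₂ + 1))) with hδ₀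
  have hδ₀pos : 0 < δ₀ := by positivity
  have hδ₀A : δ₀ ≤ δA := min_le_left _ _
  have hδ₀b : δ₀ ≤ b - t := (min_le_right _ _).trans (min_le_left _ _)
  have hδ₀w : δ₀ * (‖w‖ + C₂ + 1) ≤ 1 := by
    have : δ₀ ≤ 1 / (‖w‖ + C₂ + 1) := (min_le_right _ _).trans (min_le_right _ _)
    rwa [le_div_iff₀ (by positivity)] at this
  have hδ₀w1 : δ₀ * ‖w‖ ≤ 1 := by nlinarith [norm_nonneg w]
  have hδ₀w2 : C₂ * δ₀ ≤ 1 := by nlinarith [norm_nonneg w]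
  have hrayM : ∀ u ∈ Icc (t - r) (t + δ₀), ‖ray x t w u‖ ≤ M + 1 := by
    intro u hu
    rcases le_total u t with hut | hut
    · rw [ray_of_le x w hut]
      linarith [hM u ⟨hu.1, hut.trans ht.2.le⟩]
    · rw [ray_of_ge x w hut]
      refine (norm_add_le _ _).trans (add_le_add (hM t ⟨by linarith, ht.2.le⟩) ?_)
      rw [norm_smul, Real.norm_eq_abs, abs_of_nonneg (by linarith)]
      refine le_trans ?_ hδ₀w1
      gcongr
      linarith [hu.2]
  -- comparison with solutions restarted from the ray
  have hcomp : ∀ h, 0 < h → h < δ₀ → h < δV → ∃ y : ℝ → Euc n, Continuous y ∧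
      (∀ s ∈ Icc (t + h) (t + δ₀), histNorm n q ((fun θ => y (s + θ)) - fun θ => x (s + θ)) ≤
        h * ((C₁ + ‖w‖) * Real.exp (L * δ₀))) ∧
      ∀ s ∈ Icc (t + h) (t + δ₀), V s (fun θ => y (s + θ)) ≤
        Real.exp (K * (s - (t + h))) *
          ((v t + h * (K * v t + c + 1)) + c * (s - (t + h))) := by
    intro h hh hhδ hhV
    obtain ⟨y, hyc, hyray, hyeq⟩ := exists_truncated_solution h2 h3 hd (a := t + h)
      (b := t + δ₀) (by linarith) (by linarith) (M + 2) (continuous_ray hx.1 t w)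
    have hya : y (t + h) = ray x t w (t + h) := hyray _ le_rfl
    have hyM : ∀ s ∈ Icc (t + h - r) (t + δ₀), ‖y s‖ ≤ M + 2 := by
      intro s hs
      rcases le_total s (t + h) with hsh | hsh
      · rw [hyray s hsh]
        linarith [hrayM s ⟨by linarith [hs.1], hs.2⟩]
      · rw [hyeq s ⟨hsh, hs.2⟩]
        have i1 := hrayM (t + h) ⟨by linarith, by linarith⟩
        have i2 : ‖∫ u in (t + h)..s, f u (fun θ => clip n (M + 2) (y (u + θ))) (d u)‖ ≤
            C₂ * δ₀ := by
          refine (intervalIntegral.norm_integral_le_of_norm_le_const (C := C₂)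
            fun u hu => ?_).trans ?_
          · rw [uIoc_of_le hsh] at hu
            have hu0 : 0 ≤ u := by linarith [hu.1]
            exact hC₂ u hu0 (by linarith [hu.2, hs.2]) (fun θ => y (u + θ)) (by fun_prop) _
              (hd.1 u hu0)
          · rw [abs_of_nonneg (by linarith)]
            gcongr
            linarith [hs.2]
        linarith [norm_add_le (ray x t w (t + h))
          (∫ u in (t + h)..s, f u (fun θ => clip n (M + 2) (y (u + θ))) (d u))]
    have hysol : SolOn n l f d (t + h) (t + δ₀) y :=
      SolOn.of_truncated h3 hd (by linarith) hyc hyM (by rw [hya]; exact hyeq)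
    have hxsol : SolOn n l f d (t + h) (t + δ₀) x :=
      (hxt.mono_left h2 h3 hd ht0 (by linarith)).mono_right (by linarith)
    have hearly : ∀ s ≤ t + h, ‖y s - x s‖ ≤ h * (C₁ + ‖w‖) := by
      intro s hs
      rw [hyray s hs]
      rcases le_total s t with hst | hst
      · rw [ray_of_le x w hst, sub_self, norm_zero]; positivity
      · rw [ray_of_ge x w hst]
        have i1 := hC₁ d hd x b le_rfl hxt (fun u hu => by linarith [hM u hu]) t
          ⟨le_rfl, ht.2.le⟩ s ⟨hst, by linarith⟩
        have i2 : ‖(s - t) • w‖ ≤ h * ‖w‖ := by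
          rw [norm_smul, Real.norm_eq_abs, abs_of_nonneg (by linarith)]
          gcongr
          linarith
        have i3 : C₁ * (s - t) ≤ C₁ * h := by gcongr; linarith
        calc ‖x t + (s - t) • w - x s‖ = ‖(s - t) • w - (x s - x t)‖ := by congr 1; abel
          _ ≤ ‖(s - t) • w‖ + ‖x s - x t‖ := norm_sub_le _ _
          _ ≤ _ := by linarith
    have hexp1 : 1 ≤ Real.exp (L * δ₀) := Real.one_le_exp (by positivity)
    have hall : ∀ s ≤ t + δ₀, ‖y s - x s‖ ≤ h * ((C₁ + ‖w‖) * Real.exp (L * δ₀)) := by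
      intro s hs
      rw [← mul_assoc]
      rcases le_total s (t + h) with hsh | hsh
      · refine (hearly s hsh).trans (le_mul_of_one_le_right (by positivity) hexp1)
      · refine (hL d hd (t + h) (t + δ₀) y x (by linarith) (by linarith) (by linarith) hysol hxsol
          hyM (fun u hu => ?_) _ (by positivity) (fun u hu => hearly u hu.2) s ⟨hsh, hs⟩).trans ?_
        · linarith [hM u ⟨by linarith [hu.1], by linarith [hu.2]⟩]
        · gcongr
          linarith
    refine ⟨y, hyc, fun s hs => histNorm_le (by positivity) fun θ hθ =>
      hall _ (by linarith [hθ.2, hs.2]), fun s hs => ?_⟩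
    have hy1 : V (t + h) (fun θ => y (t + h + θ)) ≤ v t + h * (K * v t + c + 1) := by
      refine (hV.le_of_eqOn (by linarith) (by fun_prop) fun θ hθ => ?_).trans
        (hVd h (fun _ => 0) hh hhV continuousOn_const ?_)
      · simp only [smul_zero, add_zero]
        rw [Eop_eq_ray]
        exact hyray _ (by linarith [hθ.2])
      · exact lt_of_le_of_lt (histNorm_le le_rfl fun θ _ => by simp) hδV
    have hfin := growth_of_rightSlopeLE (v := fun s => V s fun θ => y (s + θ)) (A := ∅) hs.1
      (by simp) hK hc (fun u hu => hVnn u _ (by linarith [hu.1]) (by fun_prop))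
      (fun u hu => hV.leftLSC hyc (by linarith) hu.1.le)
      (fun u hu _ => (hysol.mono_right hs.2).rightSlopeLE h2 h3 hd (by linarith) hu
        (hright d hd y hyc u (by linarith [hu.1])
          (hgap u ⟨by linarith [hu.1], by linarith [hu.2, hs.2]⟩))
        (hgrow u _ _ (by linarith [hu.1]) (by linarith [hu.2, hs.2]) (by fun_prop)
          (hd.1 u (by linarith [hu.1])))) (by simp)
    refine hfin.trans ?_
    have := sub_nonneg.2 hs.1
    gcongr
  have hvt : 0 ≤ v t := hVnn t _ ht0 (by have := hx.1; fun_prop)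
  have hbound : ∀ s ∈ Ioc t (t + δ₀), v s ≤ Real.exp (K * (s - t)) * (v t + c * (s - t)) := by
    intro s hs
    refine le_of_forall_pos_le_add fun ε hε => ?_
    obtain ⟨δ, hδ, hlsc⟩ := hV s (fun θ => x (s + θ)) (by linarith [hs.1])
      (by have := hx.1; fun_prop) (ε / 2) (half_pos hε)
    set P := (C₁ + ‖w‖) * Real.exp (L * δ₀) with hP
    have hPnn : 0 ≤ P := by positivity
    set Q := Real.exp (K * (s - t)) * (K * v t + c + 1) with hQ
    have hQpos : 0 < Q := by positivity
    have hst : 0 < s - t := sub_pos.2 hs.1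
    have hmpos : 0 < min (min δ₀ δV) (min (s - t) (min (δ / (P + 1)) (ε / (2 * Q)))) := by
      positivity
    obtain ⟨h, hh, hlt⟩ := exists_between hmpos
    simp only [lt_min_iff] at hlt
    obtain ⟨⟨g1, g2⟩, g3, g4, g5⟩ := hlt
    obtain ⟨y, hyc, hyd, hyV⟩ := hcomp h hh g1 g2
    have hsI : s ∈ Icc (t + h) (t + δ₀) := ⟨by linarith, hs.2⟩
    have k1 := hyd s hsI
    have k2 := hyV s hsI
    rw [lt_div_iff₀ (by positivity)] at g4 g5
    have k3 := hlsc s (fun θ => y (s + θ)) (by linarith [hs.1]) (by fun_prop)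
      (by rw [sub_self, abs_zero]; nlinarith)
    have k4 : Real.exp (K * (s - (t + h))) * ((v t + h * (K * v t + c + 1)) + c * (s - (t + h))) ≤
        Real.exp (K * (s - t)) * ((v t + h * (K * v t + c + 1)) + c * (s - t)) := by
      have : 0 ≤ s - (t + h) := by linarith
      gcongr <;> linarith
    have k5 : Real.exp (K * (s - t)) * ((v t + h * (K * v t + c + 1)) + c * (s - t)) =
        Real.exp (K * (s - t)) * (v t + c * (s - t)) + h * Q := by rw [hQ]; ring
    simp only [hv] at *
    linarith
  intro ε hε
  have hcont : ContinuousAt (fun s => Real.exp (K * (s - t)) * (v t + c * (s - t))) t := by fun_prop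
  obtain ⟨δ, hδ, h⟩ := hcont.rightUSC ε hε
  refine ⟨min δ δ₀, by positivity, fun s hs hsδ => ?_⟩
  have e1 := h s hs (hsδ.trans_le (min_le_left _ _))
  have e2 := hbound (t + s) ⟨by linarith, by linarith [hsδ.trans_le (min_le_right _ _)]⟩
  simp only [sub_self, mul_zero, Real.exp_zero, add_zero, one_mul] at e1
  exact e2.trans e1

end AlongSolutions

/-! ### A priori bounds and global existence -/

/-- A functional on `C([-q,0];ℝⁿ)` with `K∞` bounds whose derivative along the equation grows at
most affinely in the functional, locally uniformly in time. -/
structure GrowthFunctional (n l : ℕ) (r q : ℝ) (D : Set (Euc l))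
    (f : ℝ → (ℝ → Euc n) → Euc l → Euc n) (V : ℝ → (ℝ → Euc n) → ℝ) (a₁ a₂ β₁ : ℝ → ℝ) :
    Prop where
  delay_nonneg : 0 ≤ r
  h1 : H1 n l r D f
  h2 : H2 n l r D f
  h3 : H3 n l r D f
  nonneg : ∀ t x, 0 ≤ t → ContinuousOn x (Icc (-q) 0) → 0 ≤ V t x
  lsc : HistLSC n q V
  lower_kInf : IsKInf a₁
  upper_kInf : IsKInf a₂
  weight_kPlus : IsKPlus β₁
  bounds : ∀ t x, 0 ≤ t → ContinuousOn x (Icc (-q) 0) →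
    a₁ ‖x 0‖ ≤ V t x ∧ V t x ≤ a₂ (β₁ t * histNorm n q x)
  grows : ∀ T, ∃ K c, 0 ≤ K ∧ 0 ≤ c ∧ GrowsAffinely n l q D f V T K c

namespace GrowthFunctional

variable {n l : ℕ} {r q : ℝ} {D : Set (Euc l)} {f : ℝ → (ℝ → Euc n) → Euc l → Euc n}
  {V : ℝ → (ℝ → Euc n) → ℝ} {a₁ a₂ β₁ : ℝ → ℝ}

theorem rightUSC (G : GrowthFunctional n l r q D f V a₁ a₂ β₁) {d : ℝ → Euc l} (hd : MD l D d)
    {a b : ℝ} (ha : 0 ≤ a) {x : ℝ → Euc n} (hx : SolOn n l f d a b x) {t : ℝ} (ht : t ∈ Ico a b) :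
    RightUSC (fun s => V s fun θ => x (s + θ)) t := by
  obtain ⟨K, c, hK, hc, hgrow⟩ := G.grows b
  exact hx.rightUSC G.delay_nonneg G.h1 G.h2 G.h3 G.nonneg G.lsc hK hc hgrow hd ha le_rfl ht

theorem exists_bound (G : GrowthFunctional n l r q D f V a₁ a₂ β₁) (T : ℝ) {s : ℝ} (hs : 0 ≤ s) :
    ∃ M, 0 ≤ M ∧ ∀ d, MD l D d → ∀ a b x, 0 ≤ a → a ≤ b → b ≤ T → SolOn n l f d a b x →
      (∀ t ≤ a, ‖x t‖ ≤ s) → ∀ t ∈ Icc a b, V t (fun θ => x (t + θ)) ≤ M ∧ ‖x t‖ ≤ M := by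
  obtain ⟨K, c, hK, hc, hgrow⟩ := G.grows T
  obtain ⟨A, hA, hright⟩ := G.h3.exists_right
  obtain ⟨B, hB⟩ := (isCompact_Icc (a := (0 : ℝ)) (b := T)).exists_bound_of_continuousOn
    (G.weight_kPlus.1.mono Icc_subset_Ici_self)
  set M₁ := Real.exp (K * |T|) * (a₂ (max B 0 * s) + c * |T|) with hM₁
  obtain ⟨M₂, hM₂⟩ := eventually_atTop.1 (G.lower_kInf.2.2.2.2.eventually_gt_atTop M₁)
  refine ⟨max M₁ (max M₂ 0), le_max_of_le_right (le_max_right _ _),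
    fun d hd a b x ha hab hbT hx hxs t ht => ?_⟩
  have ht0 : 0 ≤ t := ha.trans ht.1
  have hxc := hx.1
  have hva : V a (fun θ => x (a + θ)) ≤ a₂ (max B 0 * s) := by
    refine (G.bounds a _ ha (by fun_prop)).2.trans
      (G.upper_kInf.2.1.monotoneOn ?_ ?_ ?_)
    · exact mul_nonneg (G.weight_kPlus.2 a ha).le histNorm_nonneg
    · exact mul_nonneg (le_max_right _ _) hs
    · refine mul_le_mul ?_ (histNorm_le hs fun θ hθ => hxs _ (by linarith [hθ.2]))
        histNorm_nonneg (le_max_right _ _)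
      exact ((le_abs_self _).trans (hB a ⟨ha, hab.trans hbT⟩)).trans (le_max_left _ _)
  have hvt : V t (fun θ => x (t + θ)) ≤ M₁ := by
    have h := growth_of_rightSlopeLE (v := fun s => V s fun θ => x (s + θ)) (A := A) ht.1
      (finite_inter_Icc_of_locallyFinite hA a t ha) hK hc
      (fun u hu => G.nonneg u _ (ha.trans hu.1) (by fun_prop))
      (fun u hu => G.lsc.leftLSC hxc ha hu.1.le)
      (fun u hu huA => (hx.mono_right ht.2).rightSlopeLE G.h2 G.h3 hd ha hu
        (hright d hd x hxc u (ha.trans hu.1) huA)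
        (hgrow u _ _ (ha.trans hu.1) (by linarith [hu.2, ht.2]) (by fun_prop)
          (hd.1 u (ha.trans hu.1))))
      (fun u hu _ => G.rightUSC hd ha (hx.mono_right ht.2) hu)
    refine h.trans ?_
    have hsub : t - a ≤ |T| := by linarith [le_abs_self T, ht.2]
    have hva0 : 0 ≤ V a (fun θ => x (a + θ)) := G.nonneg a _ ha (by fun_prop)
    have : 0 ≤ t - a := sub_nonneg.2 ht.1
    rw [hM₁]
    gcongr
  refine ⟨hvt.trans (le_max_left _ _), le_max_of_le_right (le_max_of_le_left ?_)⟩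
  by_contra! hcon
  have h1 := hM₂ _ hcon.le
  have h2 := (G.bounds t (fun θ => x (t + θ)) ht0 (by fun_prop)).1
  simp only [add_zero] at h2
  linarith

end GrowthFunctional

theorem SolOn.eqOn {n l : ℕ} {r : ℝ} {D : Set (Euc l)} {f : ℝ → (ℝ → Euc n) → Euc l → Euc n}
    {d : ℝ → Euc l} {a b : ℝ} {x y : ℝ → Euc n} (hr : 0 ≤ r) (h1 : H1 n l r D f)
    (h2 : H2 n l r D f) (h3 : H3 n l r D f) (hd : MD l D d) (ha : 0 ≤ a)
    (hx : SolOn n l f d a b x) (hy : SolOn n l f d a b y) (hxy : EqOn x y (Icc (a - r) a)) :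
    EqOn x y (Icc a b) := by
  intro t ht
  obtain ⟨M, hM0, hM⟩ := exists_bound_of_continuous hx.1 (a - r) b
  obtain ⟨N, hN0, hN⟩ := exists_bound_of_continuous hy.1 (a - r) b
  obtain ⟨L, -, hL⟩ := exists_gronwall_constant hr h1 h2 h3 b (M := max M N) (by positivity)
  have := hL d hd a b x y ha (ht.1.trans ht.2) le_rfl hx hy
    (fun s hs => (hM s hs).trans (le_max_left _ _))
    (fun s hs => (hN s hs).trans (le_max_right _ _)) 0 le_rfl
    (fun s hs => by simp [hxy hs]) t ht
  rw [zero_mul] at this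
  exact sub_eq_zero.1 (norm_le_zero_iff.1 this)

namespace GrowthFunctional

variable {n l : ℕ} {r q : ℝ} {D : Set (Euc l)} {f : ℝ → (ℝ → Euc n) → Euc l → Euc n}
  {V : ℝ → (ℝ → Euc n) → ℝ} {a₁ a₂ β₁ : ℝ → ℝ}

theorem exists_solOn (G : GrowthFunctional n l r q D f V a₁ a₂ β₁) {d : ℝ → Euc l} (hd : MD l D d)
    {a b : ℝ} (ha : 0 ≤ a) (hab : a ≤ b) {φ : ℝ → Euc n} (hφ : Continuous φ) {s : ℝ} (hs : 0 ≤ s)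
    (hφs : ∀ t ≤ a, ‖φ t‖ ≤ s) : ∃ x, (∀ t ≤ a, x t = φ t) ∧ SolOn n l f d a b x := by
  obtain ⟨M, hM0, hM⟩ := G.exists_bound b hs
  set N := max M s + 1 with hN
  have hMN : M < N := lt_of_le_of_lt (le_max_left M s) (lt_add_one _)
  have hsN : s < N := lt_of_le_of_lt (le_max_right M s) (lt_add_one _)
  obtain ⟨x, hxc, hxφ, hxeq⟩ := exists_truncated_solution G.h2 G.h3 hd ha hab N hφ
  have hxa : x a = φ a := hxφ a le_rfl
  have hsol : ∀ t ≤ b, (∀ u ∈ Icc a t, ‖x u‖ ≤ N) → SolOn n l f d a t x := by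
    intro t htb ht
    refine SolOn.of_truncated G.h3 hd ha hxc (fun u hu => ?_)
      (fun u hu => by rw [hxa]; exact hxeq u ⟨hu.1, hu.2.trans htb⟩)
    rcases le_total u a with hua | hua
    · rw [hxφ u hua]; exact (hφs u hua).trans hsN.le
    · exact ht u ⟨hua, hu.2⟩
  refine ⟨x, hxφ, hsol b le_rfl ?_⟩
  refine real_induction (fun t ht h => ?_) fun t ht h => ?_
  · rcases ht.1.eq_or_lt with rfl | hat
    · rw [hxa]; exact (hφs _ le_rfl).trans hsN.le
    · have hcl : t ∈ closure (Ico a t) := by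
        rw [closure_Ico hat.ne]; exact ⟨hat.le, le_rfl⟩
      exact (isClosed_le hxc.norm continuous_const).closure_subset_iff.2 h hcl
  · have hlt : ‖x t‖ < N := by
      refine lt_of_le_of_lt (hM d hd a t x ha ht.1 ht.2.le (hsol t ht.2.le h)
        (fun u hu => by rw [hxφ u hu]; exact hφs u hu) t ⟨ht.1, le_rfl⟩).2 hMN
    obtain ⟨δ, hδ, hball⟩ := Metric.isOpen_iff.1 (isOpen_lt hxc.norm continuous_const) t hlt
    refine ⟨δ, hδ, fun u hu => le_of_lt (hball ?_)⟩
    rw [Metric.mem_ball, Real.dist_eq, abs_of_pos (by linarith [hu.1])]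
    linarith [hu.2]

theorem exists_global (G : GrowthFunctional n l r q D f V a₁ a₂ β₁) {d : ℝ → Euc l}
    (hd : MD l D d) {a : ℝ} (ha : 0 ≤ a) {φ : ℝ → Euc n} (hφ : Continuous φ) {s : ℝ} (hs : 0 ≤ s)
    (hφs : ∀ t ≤ a, ‖φ t‖ ≤ s) : ∃ x, (∀ t ≤ a, x t = φ t) ∧ ∀ b, SolOn n l f d a b x := by
  choose X hXφ hX using fun k : ℕ => G.exists_solOn hd ha (b := a + k) (by simp) hφ hs hφs
  have hXX : ∀ j k : ℕ, ∀ t, t ≤ a + j → t ≤ a + k → X j t = X k t := by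
    have hle : ∀ j k : ℕ, j ≤ k → ∀ t, t ≤ a + j → X j t = X k t := by
      intro j k hjk t htj
      have hjk' : (j : ℝ) ≤ k := Nat.cast_le.2 hjk
      rcases le_total t a with hta | hta
      · rw [hXφ j t hta, hXφ k t hta]
      · exact SolOn.eqOn G.delay_nonneg G.h1 G.h2 G.h3 hd ha (hX j)
          ((hX k).mono_right (by linarith))
          (fun u hu => by rw [hXφ j u hu.2, hXφ k u hu.2]) ⟨hta, htj⟩
    intro j k t hj hk
    rcases le_total j k with h | h
    · exact hle j k h t hj
    · exact (hle k j h t hk).symm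
  set x : ℝ → Euc n := fun t => X ⌈t - a⌉₊ t with hx
  have hxX : ∀ k : ℕ, ∀ t ≤ a + k, x t = X k t := fun k t ht =>
    hXX _ k t (by linarith [Nat.le_ceil (t - a)]) ht
  have hxc : Continuous x := by
    refine continuous_iff_continuousAt.2 fun t => ?_
    obtain ⟨k, hk⟩ := exists_nat_gt (t - a)
    refine (hX k).1.continuousAt.congr ?_
    filter_upwards [Iio_mem_nhds (show t < a + k by linarith)] with u hu
    exact (hxX k u (le_of_lt hu)).symm
  refine ⟨x, fun t ht => ?_, fun b => ?_⟩
  · rw [hxX 0 t (by simpa using ht)]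
    exact hXφ 0 t ht
  · obtain ⟨k, hk⟩ := exists_nat_gt (b - a)
    have hak : x a = X k a := hxX k a (by simp)
    refine SolOn.congr_integrand hxc (g := fun s => f s (fun θ => X k (s + θ)) (d s))
      (fun t ht => ?_) fun u hu => ?_
    · rw [hxX k t (by linarith [ht.2]), hak]
      exact (hX k).2 t ⟨ht.1, by linarith [ht.2]⟩
    · have hu0 := ha.trans hu.1.le
      exact G.h3.congr hu0 (by fun_prop) (fun θ hθ => (hxX k _ (by linarith [hu.2, hθ.2])).symm)
        (hd.1 u hu0)

end GrowthFunctional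

section Extension

variable {n l : ℕ} {r : ℝ} {D : Set (Euc l)} {f : ℝ → (ℝ → Euc n) → Euc l → Euc n}
  {d : ℝ → Euc l} {a : ℝ} {x : ℝ → Euc n}

theorem isSolGlobal_of_solOn (h2 : H2 n l r D f) (h3 : H3 n l r D f) (hd : MD l D d) (ha : 0 ≤ a)
    (hx : ∀ b, SolOn n l f d a b x) : IsSolGlobal n l r f d a x :=
  ⟨(hx a).1.continuousOn, fun t ht => ⟨h3.intervalIntegrable h2 hd (hx a).1 ha (ha.trans ht),
    (hx t).2 t ⟨ht, le_rfl⟩⟩⟩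

/-- Freezing a global solution before its initial interval gives a globally continuous curve. -/
theorem IsSolGlobal.solOn (hr : 0 ≤ r) (h3 : H3 n l r D f) (hd : MD l D d) (ha : 0 ≤ a)
    (hx : IsSolGlobal n l r f d a x) (b : ℝ) : SolOn n l f d a b fun t => x (max t (a - r)) := by
  have hc : Continuous fun t => x (max t (a - r)) :=
    hx.1.comp_continuous (by fun_prop) fun t => mem_Ici.2 (le_max_right _ _)
  refine SolOn.congr_integrand hc (g := fun s => f s (fun θ => x (s + θ)) (d s))
    (fun t ht => ?_) fun u hu => ?_
  · simp only [max_eq_left (show a - r ≤ a by linarith),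
      max_eq_left (show a - r ≤ t by linarith [ht.1])]
    exact (hx.2 t ht.1).2
  · have hu0 := ha.trans hu.1.le
    refine h3.congr hu0 (x := fun θ => x (max (u + θ) (a - r)))
      (hc.comp (continuous_const.add continuous_id)).continuousOn (fun θ hθ => ?_)
      (hd.1 u hu0)
    simp only [max_eq_left (show a - r ≤ u + θ by linarith [hθ.1, hu.1])]

end Extension

/-! ### Decay of scalar functions satisfying a comparison inequality -/

theorem RightSlopeLE.max_of_lt {g k : ℝ → ℝ} {t c : ℝ} (hg : RightUSC g t)
    (hk : RightSlopeLE k t c) (hlt : g t < k t) : RightSlopeLE (fun s => max (g s) (k s)) t c := by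
  intro ε hε
  obtain ⟨δ₁, hδ₁, h₁⟩ := hg ((k t - g t) / 2) (by linarith)
  obtain ⟨δ₂, hδ₂, h₂⟩ := hk ε hε
  have hgap : 0 < k t - g t := sub_pos.2 hlt
  refine ⟨min (min δ₁ δ₂) ((k t - g t) / (2 * (|c| + 1))), by positivity, fun h hh hhδ => ?_⟩
  simp only [lt_min_iff] at hhδ
  obtain ⟨⟨e1, e2⟩, e3⟩ := hhδ
  rw [lt_div_iff₀ (by positivity)] at e3
  beta_reduce
  rw [max_eq_right hlt.le]
  refine max_le ?_ (h₂ h hh e2)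
  have := h₁ h hh e1
  have : 0 < h * ε := by positivity
  nlinarith [neg_abs_le c]

theorem RightSlopeLE.max {g k : ℝ → ℝ} {t c : ℝ} (hg : RightUSC g t) (hk : RightUSC k t)
    (hgs : k t ≤ g t → RightSlopeLE g t c) (hks : g t ≤ k t → RightSlopeLE k t c) :
    RightSlopeLE (fun s => max (g s) (k s)) t c := by
  rcases lt_trichotomy (g t) (k t) with hlt | heq | hgt
  · exact RightSlopeLE.max_of_lt hg (hks hlt.le) hlt
  · intro ε hε
    obtain ⟨δ₁, hδ₁, h₁⟩ := hgs heq.ge ε hε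
    obtain ⟨δ₂, hδ₂, h₂⟩ := hks heq.le ε hε
    refine ⟨min δ₁ δ₂, by positivity, fun h hh hhδ => ?_⟩
    rw [lt_min_iff] at hhδ
    beta_reduce
    rw [← heq, max_self]
    exact max_le (h₁ h hh hhδ.1) (by have := h₂ h hh hhδ.2; rwa [← heq] at this)
  · simpa only [max_comm] using RightSlopeLE.max_of_lt hk (hgs hgt.le) hgt

/-- If `v` satisfies `v' ≤ b (-ρ(v) + m)` whenever it dominates the solution `e` of the same
differential equation, then `v` decays, uniformly in the initial data. -/
theorem exists_decay_time {b m e B P ρ : ℝ → ℝ} (hb : ∀ t, 0 ≤ t → 0 ≤ b t)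
    (he : ∀ t, 0 ≤ t → HasDerivAt e (b t * (-ρ (e t) + m t)) t)
    (hB : ∀ t, 0 ≤ t → HasDerivAt B (b t) t) (hBtop : Tendsto B atTop atTop)
    (hP : ∀ t, 0 ≤ t → HasDerivAt P (b t * m t) t)
    {I : ℝ} (hPI : ∀ s t, 0 ≤ s → s ≤ t → P t ≤ P s + I)
    (hPtail : ∀ ε > 0, ∃ S, ∀ s t, S ≤ s → s ≤ t → P t ≤ P s + ε)
    (hρcont : ContinuousOn ρ (Ici 0)) (hρ0 : ρ 0 = 0) (hρpos : ∀ s, 0 < s → 0 < ρ s)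
    {A : Set ℝ} (hA : ∀ C : ℝ, (A ∩ Icc 0 C).Finite) (T M : ℝ) {ε : ℝ} (hε : 0 < ε) :
    ∃ H, ∀ v : ℝ → ℝ, ∀ a, 0 ≤ a → a ≤ T → v a ≤ M → (∀ t, a ≤ t → 0 ≤ v t) →
      (∀ s t, a ≤ s → s < t → LeftLSC v s t) → (∀ t, a ≤ t → RightUSC v t) →
      (∀ t, a ≤ t → t ∉ A → e t ≤ v t → RightSlopeLE v t (b t * (-ρ (v t) + m t))) →
      ∀ t, H ≤ t → a ≤ t → v t ≤ ε := by
  have hρnn : ∀ s, 0 ≤ s → 0 ≤ ρ s := fun s hs => by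
    rcases hs.eq_or_lt with rfl | h
    · exact hρ0.ge
    · exact (hρpos s h).le
  obtain ⟨E, hE⟩ := (isCompact_Icc (a := (0 : ℝ)) (b := T)).exists_bound_of_continuousOn
    (f := e) fun t ht => (he t ht.1).continuousAt.continuousWithinAt
  set Z := max M E + I with hZ
  obtain ⟨S₀, hS₀⟩ := hPtail (ε / 2) (half_pos hε)
  set S := max S₀ (max T 0) with hS
  obtain ⟨k, hk0, hk⟩ : ∃ k > 0, ∀ u ∈ Icc (ε / 2) Z, k ≤ ρ u := by
    rcases (Icc (ε / 2) Z).eq_empty_or_nonempty with h | h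
    · exact ⟨1, one_pos, by simp [h]⟩
    · obtain ⟨u, hu, hmin⟩ := isCompact_Icc.exists_isMinOn h
        (hρcont.mono fun u hu => mem_Ici.2 (by linarith [hu.1]))
      exact ⟨ρ u, hρpos u (by linarith [hu.1]), fun w hw => hmin hw⟩
  obtain ⟨t₁, ht₁, hSt₁⟩ := ((hBtop.eventually_ge_atTop (B S + (Z + I + 1) / k)).and
    (eventually_ge_atTop S)).exists
  refine ⟨t₁, fun v a ha haT hva hv0 hlsc husc hslope => ?_⟩
  set z : ℝ → ℝ := fun t => max (v t) (e t) with hz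
  have hz0 : ∀ t, a ≤ t → 0 ≤ z t := fun t ht => (hv0 t ht).trans (le_max_left _ _)
  have hzlsc : ∀ s t, a ≤ s → s < t → LeftLSC z s t := fun s t has hst =>
    (hlsc s t has hst).max ((he t (by linarith)).continuousAt.leftLSC s)
  have hzusc : ∀ t, a ≤ t → RightUSC z t := fun t hat =>
    (husc t hat).max (he t (ha.trans hat)).continuousAt.rightUSC
  have hzslope : ∀ t, a ≤ t → t ∉ A → RightSlopeLE z t (b t * (-ρ (z t) + m t)) := by
    intro t hat htA
    refine RightSlopeLE.max (husc t hat) (he t (ha.trans hat)).continuousAt.rightUSC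
      (fun h => ?_) fun h => ?_
    · rw [hz]; simp only [max_eq_left h]; exact hslope t hat htA h
    · rw [hz]; simp only [max_eq_right h]; exact (he t (ha.trans hat)).rightSlopeLE
  have hdec : ∀ s t, a ≤ s → s ≤ t → z t ≤ z s + (P t - P s) := by
    intro s t has hst
    have := le_of_rightSlopeLE (g := fun u => z u + -P u) hst
      (finite_inter_Icc_of_locallyFinite hA s t (ha.trans has))
      (fun u hu => (hzlsc s u has hu.1).add_continuous
        (hP u (by linarith [hu.1])).continuousAt.neg)
      (fun u hu huA => ((hzslope u (has.trans hu.1) huA).add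
        (hP u (by linarith [hu.1])).neg.rightSlopeLE).mono ?_)
      (fun u hu _ => (hzusc u (has.trans hu.1)).add_continuous
        (hP u (by linarith [hu.1])).continuousAt.neg)
    · linarith
    · nlinarith [mul_nonneg (hb u (by linarith [hu.1])) (hρnn _ (hz0 u (has.trans hu.1)))]
  have hza : z a ≤ max M E :=
    max_le_max hva ((le_abs_self _).trans (hE a ⟨ha, haT⟩))
  have hzZ : ∀ t, a ≤ t → z t ≤ Z := fun t hat => by
    have := hdec a t le_rfl hat
    have := hPI a t ha hat
    linarith
  have hSa : a ≤ S := haT.trans ((le_max_left _ _).trans (le_max_right _ _))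
  have hS0 : 0 ≤ S := (le_max_right T 0).trans (le_max_right _ _)
  obtain ⟨s, hs, hzs⟩ : ∃ s ∈ Icc S t₁, z s < ε / 2 := by
    by_contra! hcon
    have := le_of_rightSlopeLE (g := fun u => (z u + -P u) + k * B u) hSt₁
      (finite_inter_Icc_of_locallyFinite hA S t₁ hS0)
      (fun u hu => ((hzlsc S u hSa hu.1).add_continuous
        (hP u (by linarith [hu.1])).continuousAt.neg).add_continuous
        ((hB u (by linarith [hu.1])).const_mul k).continuousAt)
      (fun u hu huA => (((hzslope u (hSa.trans hu.1) huA).add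
        (hP u (by linarith [hu.1])).neg.rightSlopeLE).add
        ((hB u (by linarith [hu.1])).const_mul k).rightSlopeLE).mono ?_)
      (fun u hu _ => ((hzusc u (hSa.trans hu.1)).add_continuous
        (hP u (by linarith [hu.1])).continuousAt.neg).add_continuous
        ((hB u (by linarith [hu.1])).const_mul k).continuousAt)
    · have e1 := hz0 t₁ (hSa.trans hSt₁)
      have e2 := hzZ S hSa
      have e3 := hPI S t₁ hS0 hSt₁
      have e4 : k * B S + (Z + I + 1) ≤ k * B t₁ := by
        calc k * B S + (Z + I + 1) = k * (B S + (Z + I + 1) / k) := by field_simp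
          _ ≤ _ := by gcongr
      linarith
    · have hbu := hb u (by linarith [hu.1])
      have hku := hk (z u) ⟨hcon u ⟨hu.1, hu.2.le⟩, hzZ u (hSa.trans hu.1)⟩
      nlinarith [mul_le_mul_of_nonneg_left hku hbu]
  intro t ht hat
  have e1 := hdec s t (hSa.trans hs.1) (hs.2.trans ht)
  have e2 := hS₀ s t ((le_max_left _ _).trans hs.1) (hs.2.trans ht)
  have e3 : v t ≤ z t := le_max_left _ _
  linarith

/-! ### Attractivity -/

theorem exists_decay_time_of_comparison {β₄ μ ρ ηc : ℝ → ℝ} (hβ₄ : IsKPlus β₄)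
    (hβ₄div : Tendsto (fun T => ∫ s in (0:ℝ)..T, β₄ s) atTop atTop)
    (hμcont : ContinuousOn μ (Ici 0)) (hμnn : ∀ t, 0 ≤ t → 0 ≤ μ t)
    (hμint : IntegrableOn μ (Ici 0)) (hρcont : ContinuousOn ρ (Ici 0)) (hρ0 : ρ 0 = 0)
    (hρpos : ∀ s, 0 < s → 0 < ρ s)
    (hηcode : ∀ t, 0 ≤ t → HasDerivAt ηc (-(ρ (ηc t)) + μ t) t)
    {A : Set ℝ} (hA : ∀ C : ℝ, (A ∩ Icc 0 C).Finite) (T M : ℝ) {ε : ℝ} (hε : 0 < ε) :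
    ∃ H, ∀ v : ℝ → ℝ, ∀ a, 0 ≤ a → a ≤ T → v a ≤ M → (∀ t, a ≤ t → 0 ≤ v t) →
      (∀ s t, a ≤ s → s < t → LeftLSC v s t) → (∀ t, a ≤ t → RightUSC v t) →
      (∀ t, a ≤ t → t ∉ A → ηc (∫ s in (0:ℝ)..t, β₄ s) ≤ v t →
        RightSlopeLE v t (-(β₄ t * ρ (v t)) + β₄ t * μ (∫ s in (0:ℝ)..t, β₄ s))) →
      ∀ t, H ≤ t → a ≤ t → v t ≤ ε := by
  set b : ℝ → ℝ := fun t => β₄ (max t 0) with hb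
  have hbc : Continuous b := hβ₄.1.comp_continuous (by fun_prop) fun t => mem_Ici.2 (le_max_right _ _)
  have hbpos : ∀ t, 0 < b t := fun t => hβ₄.2 _ (le_max_right _ _)
  set B : ℝ → ℝ := fun t => ∫ s in (0:ℝ)..t, b s with hB
  have hBeq : ∀ t, 0 ≤ t → B t = ∫ s in (0:ℝ)..t, β₄ s := fun t ht => by
    refine intervalIntegral.integral_congr fun s hs => ?_
    rw [uIcc_of_le ht] at hs
    simp only [hb, max_eq_left hs.1]
  have hBd : ∀ t, HasDerivAt B (b t) t := fun t => (hbc.integral_hasStrictDerivAt 0 t).hasDerivAt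
  have hBnn : ∀ t, 0 ≤ t → 0 ≤ B t := fun t ht =>
    intervalIntegral.integral_nonneg ht fun s _ => (hbpos s).le
  have hBtop : Tendsto B atTop atTop := by
    refine hβ₄div.congr' ?_
    filter_upwards [eventually_ge_atTop 0] with t ht using (hBeq t ht).symm
  set μ' : ℝ → ℝ := fun t => μ (max t 0) with hμ'
  have hμc : Continuous μ' :=
    hμcont.comp_continuous (by fun_prop) fun t => mem_Ici.2 (le_max_right _ _)
  have hμ'nn : ∀ t, 0 ≤ μ' t := fun t => hμnn _ (le_max_right _ _)
  set N : ℝ → ℝ := fun t => ∫ s in (0:ℝ)..t, μ' s with hN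
  have hNd : ∀ t, HasDerivAt N (μ' t) t := fun t => (hμc.integral_hasStrictDerivAt 0 t).hasDerivAt
  have hNmono : Monotone N := by
    refine monotone_of_deriv_nonneg (fun t => (hNd t).differentiableAt) fun t => ?_
    rw [(hNd t).deriv]
    exact hμ'nn t
  have hNlim : Tendsto N atTop (nhds (∫ s in Ioi 0, μ' s)) := by
    refine intervalIntegral_tendsto_integral_Ioi 0 ?_ tendsto_id
    refine (hμint.mono_set Ioi_subset_Ici_self).congr_fun (fun s hs => ?_) measurableSet_Ioi
    simp only [hμ', max_eq_left (le_of_lt (mem_Ioi.1 hs))]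
  have hNle : ∀ t, N t ≤ ∫ s in Ioi 0, μ' s := fun t => hNmono.ge_of_tendsto hNlim t
  have hNB : ∀ t, 0 ≤ t → 0 ≤ N (B t) := fun t ht =>
    intervalIntegral.integral_nonneg (hBnn t ht) fun s _ => hμ'nn s
  have hμB : ∀ t, 0 ≤ t → μ' (B t) = μ (B t) := fun t ht => by
    simp only [hμ', max_eq_left (hBnn t ht)]
  obtain ⟨H, hH⟩ := exists_decay_time (b := b) (m := fun t => μ' (B t)) (e := fun t => ηc (B t))
    (B := B) (P := fun t => N (B t)) (ρ := ρ) (I := ∫ s in Ioi 0, μ' s)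
    (fun t _ => (hbpos t).le)
    (fun t ht => by
      have := (hηcode (B t) (hBnn t ht)).comp t (hBd t)
      rwa [mul_comm, ← hμB t ht] at this)
    (fun t _ => hBd t) hBtop
    (fun t _ => by
      have := (hNd (B t)).comp t (hBd t)
      rwa [mul_comm] at this)
    (fun s t hs hst => by linarith [hNle (B t), hNB s hs])
    (fun ε hε => by
      obtain ⟨S, hS⟩ := eventually_atTop.1 ((hNlim.comp hBtop).eventually
        (eventually_gt_nhds (show (∫ s in Ioi 0, μ' s) - ε < ∫ s in Ioi 0, μ' s by linarith)))
      refine ⟨S, fun s t hs hst => ?_⟩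
      have h1 := hS s hs
      have h2 := hNle (B t)
      simp only [Function.comp] at h1
      linarith)
    hρcont hρ0 hρpos hA T M hε
  refine ⟨H, fun v a ha haT hva hv0 hlsc husc hslope => hH v a ha haT hva hv0 hlsc husc ?_⟩
  intro t hat htA het
  have ht0 : 0 ≤ t := ha.trans hat
  rw [hBeq t ht0] at het
  refine (hslope t hat htA het).mono (le_of_eq ?_)
  rw [hμB t ht0, hBeq t ht0]
  simp only [hb, max_eq_left ht0]
  ring

theorem MD.shift {l : ℕ} {D : Set (Euc l)} {d : ℝ → Euc l} (hd : MD l D d) {c : ℝ} (hc : 0 ≤ c) :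
    MD l D fun u => d (c + u) := by
  obtain ⟨hD, hright, A, hA, hcont⟩ := hd
  refine ⟨fun t ht => hD _ (by positivity), fun t ht ε hε => ?_, (fun u => c + u) ⁻¹' A,
    fun C => ?_, fun t ht htA ε hε => ?_⟩
  · obtain ⟨δ, hδ, h⟩ := hright (c + t) (by positivity) ε hε
    exact ⟨δ, hδ, fun s hs hsδ => h _ (by linarith) (by linarith)⟩
  · refine ((hA (c + C)).preimage (add_right_injective c).injOn).subset fun u hu => ?_
    exact ⟨hu.1, by linarith [hu.2.1], by linarith [hu.2.2]⟩
  · obtain ⟨δ, hδ, h⟩ := hcont (c + t) (by positivity) htA ε hε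
    exact ⟨δ, hδ, fun s hs hsδ => h _ (by positivity) (by rwa [add_sub_add_left_eq_sub])⟩

theorem SolOn.history_eq {n l : ℕ} {r : ℝ} {D : Set (Euc l)}
    {f : ℝ → (ℝ → Euc n) → Euc l → Euc n} {d : ℝ → Euc l} {a b : ℝ} {x : ℝ → Euc n}
    (h2 : H2 n l r D f) (h3 : H3 n l r D f) (hd : MD l D d) (ha : 0 ≤ a)
    (hx : SolOn n l f d a b x) {t τ : ℝ} (ht : a + τ ≤ t) (htb : t ≤ b) {θ : ℝ}
    (hθ : θ ∈ Icc (-τ) 0) :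
    x (t + θ) = x (t + -τ) + ∫ s in (-τ)..θ, f (t + s) (fun θ' => x (t + (s + θ')))
      (d (t - τ + (τ + s))) := by
  have h := hx.sub_eq h2 h3 hd ha (s := t + -τ) (t := t + θ)
    ⟨by linarith, by linarith [hθ.1, hθ.2]⟩ ⟨by linarith [hθ.1], by linarith [hθ.2]⟩
  rw [← intervalIntegral.integral_comp_add_left
    (fun u => f u (fun θ' => x (u + θ')) (d u)) t] at h
  rw [← sub_eq_iff_eq_add', h]
  refine intervalIntegral.integral_congr fun s _ => ?_
  have hs : t - τ + (τ + s) = t + s := by ring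
  simp only [hs, add_assoc]

/-- Solutions converge to zero, uniformly for bounded initial times and initial histories. -/
theorem GrowthFunctional.exists_attraction_time {n l : ℕ} {r τ : ℝ} (hτ : 0 ≤ τ) {D : Set (Euc l)}
    {f : ℝ → (ℝ → Euc n) → Euc l → Euc n} {V : ℝ → (ℝ → Euc n) → ℝ}
    {a₁ a₂ β₁ β₄ μ ρ ηc : ℝ → ℝ}
    (G : GrowthFunctional n l r (r + τ) D f V a₁ a₂ β₁) (hβ₄ : IsKPlus β₄)
    (hβ₄div : Tendsto (fun T => ∫ s in (0:ℝ)..T, β₄ s) atTop atTop)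
    (hμcont : ContinuousOn μ (Ici 0)) (hμnn : ∀ t, 0 ≤ t → 0 ≤ μ t)
    (hμint : IntegrableOn μ (Ici 0)) (hρcont : ContinuousOn ρ (Ici 0)) (hρ0 : ρ 0 = 0)
    (hρpos : ∀ s, 0 < s → 0 < ρ s)
    (hηcode : ∀ t, 0 ≤ t → HasDerivAt ηc (-(ρ (ηc t)) + μ t) t)
    (hdecr : ∀ t x d, τ ≤ t → ContinuousOn x (Icc (-(r + τ)) 0) → d ∈ D →
      ηc (∫ s in (0:ℝ)..t, β₄ s) ≤ V t x →
      (∃ dd : ℝ → Euc l, MD l D dd ∧ ∀ θ ∈ Icc (-τ) 0,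
        x θ = x (-τ) + ∫ s in (-τ)..θ, f (t + s) (fun θ' => x (s + θ')) (dd (τ + s))) →
      Vdot n (r + τ) V t x (f t x d) ≤
        ((-(β₄ t * ρ (V t x)) + β₄ t * μ (∫ s in (0:ℝ)..t, β₄ s) : ℝ) : EReal))
    (T : ℝ) {s : ℝ} (hs : 0 ≤ s) {ε : ℝ} (hε : 0 < ε) :
    ∃ H, ∀ d, MD l D d → ∀ a x, 0 ≤ a → a ≤ T → (∀ b, SolOn n l f d a b x) →
      (∀ t ≤ a, ‖x t‖ ≤ s) → ∀ t, H ≤ t → ‖x t‖ ≤ ε := by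
  obtain ⟨M, hM0, hM⟩ := G.exists_bound (T + τ) hs
  obtain ⟨A, hA, hright⟩ := G.h3.exists_right
  have ha₁ε : 0 < a₁ ε := by
    have := G.lower_kInf.2.1 (mem_Ici.2 le_rfl) (mem_Ici.2 hε.le) hε
    rwa [G.lower_kInf.2.2.1] at this
  obtain ⟨H, hH⟩ := exists_decay_time_of_comparison hβ₄ hβ₄div hμcont hμnn hμint hρcont hρ0 hρpos
    hηcode hA (T + τ) M ha₁ε
  refine ⟨max H (T + τ), fun d hd a x ha haT hx hxs t ht => ?_⟩
  have hxc := (hx a).1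
  have hat : a + τ ≤ t := by linarith [le_max_right H (T + τ)]
  have hv := hH (fun s => V s fun θ => x (s + θ)) (a + τ) (by positivity) (by linarith)
    (hM d hd a (a + τ) x ha (by linarith) (by linarith) (hx _) hxs _ ⟨by linarith, le_rfl⟩).1
    (fun u hu => G.nonneg u _ (by linarith) (by fun_prop))
    (fun u w hu huw => G.lsc.leftLSC hxc (by linarith) huw.le)
    (fun u hu => G.rightUSC hd ha (hx (u + 1)) ⟨by linarith, by linarith⟩)
    (fun u hu huA hle => (hx (u + 1)).rightSlopeLE G.h2 G.h3 hd ha ⟨by linarith, by linarith⟩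
      (hright d hd x hxc u (by linarith) huA)
      (hdecr u _ _ (by linarith) (by fun_prop) (hd.1 u (by linarith)) hle
        ⟨fun w => d (u - τ + w), hd.shift (by linarith), fun θ hθ =>
          (hx u).history_eq G.h2 G.h3 hd ha hu le_rfl hθ⟩))
    t ((le_max_left _ _).trans ht) hat
  have hlow := (G.bounds t (fun θ => x (t + θ)) (by linarith) (by fun_prop)).1
  simp only [add_zero] at hlow
  by_contra! hcon
  have := G.lower_kInf.2.1 (mem_Ici.2 hε.le) (mem_Ici.2 (norm_nonneg (x t))) hcon
  linarith

/-! ### Construction of `KL` estimates -/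

/-- A function on the quadrant which is monotone in the first variable, antitone in the second one
and does not vary too fast is continuous. -/
theorem continuousOn_quadrant_of_monotone {κ : ℝ → ℝ → ℝ} (hnn : ∀ u h, 0 ≤ κ u h)
    (hle : ∀ u h, 0 ≤ u → κ u h ≤ 1)
    (hmono : ∀ u v h, 0 ≤ u → u ≤ v → κ u h ≤ κ v h)
    (hanti : ∀ u h k, 0 ≤ u → h ≤ k → κ u k ≤ κ u h)
    (hscale : ∀ u v h, 0 ≤ u → u ≤ v → u / v * κ v h ≤ κ u h)
    (hexp : ∀ u h k, 0 ≤ u → h ≤ k → Real.exp (h - k) * κ u h ≤ κ u k)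
    (hzero : ∀ ε > 0, ∃ δ > 0, ∀ u h, 0 ≤ u → u ≤ δ → 0 ≤ h → κ u h ≤ ε) :
    ContinuousOn (fun p : ℝ × ℝ => κ p.1 p.2) (Ici 0 ×ˢ Ici 0) := by
  rintro ⟨u₀, h₀⟩ ⟨hu₀, hh₀⟩
  simp only [mem_Ici] at hu₀ hh₀
  rw [Metric.continuousWithinAt_iff]
  intro ε hε
  rcases hu₀.eq_or_lt with rfl | hu₀
  · obtain ⟨δ, hδ, h⟩ := hzero (ε / 2) (half_pos hε)
    refine ⟨δ, hδ, ?_⟩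
    rintro ⟨u, k⟩ ⟨hu, hk⟩ hdist
    simp only [mem_Ici] at hu hk
    have h1 : κ 0 h₀ ≤ ε / 2 := h 0 h₀ le_rfl hδ.le hh₀
    have h2 : κ u k ≤ ε / 2 := by
      refine h u k hu ?_ hk
      rw [Prod.dist_eq, max_lt_iff, Real.dist_eq, sub_zero] at hdist
      exact (le_abs_self u).trans hdist.1.le
    rw [Real.dist_eq, abs_lt]
    have := hnn u k
    have := hnn 0 h₀
    constructor <;> simp only <;> linarith
  · have hu : ∀ u h, 0 ≤ u → |κ u h - κ u₀ h| ≤ |u - u₀| / u₀ := by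
      intro u h hu
      rcases le_total u u₀ with hle' | hle'
      · rw [abs_sub_comm, abs_of_nonneg (sub_nonneg.2 (hmono u u₀ h hu hle')), abs_sub_comm,
          abs_of_nonneg (sub_nonneg.2 hle'), sub_div, div_self hu₀.ne']
        have e1 := hscale u u₀ h hu hle'
        have e2 := hle u₀ h hu₀.le
        have e3 : u / u₀ ≤ 1 := (div_le_one hu₀).2 hle'
        nlinarith
      · rw [abs_of_nonneg (sub_nonneg.2 (hmono u₀ u h hu₀.le hle')),
          abs_of_nonneg (sub_nonneg.2 hle')]
        have hupos : 0 < u := hu₀.trans_le hle'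
        have e1 := hscale u₀ u h hu₀.le hle'
        have e2 := hle u h hu
        have e3 : u₀ / u ≤ 1 := (div_le_one hupos).2 hle'
        have e4 : (u - u₀) / u ≤ (u - u₀) / u₀ := by gcongr
        rw [sub_div, div_self hupos.ne'] at e4
        nlinarith
    have hh : ∀ h k, |κ u₀ h - κ u₀ k| ≤ |h - k| := by
      have key : ∀ h k, h ≤ k → κ u₀ h - κ u₀ k ≤ k - h := by
        intro h k hhk
        have e1 := hexp u₀ h k hu₀.le hhk
        have e2 := Real.add_one_le_exp (h - k)
        nlinarith [hnn u₀ h, hle u₀ h hu₀.le]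
      intro h k
      rcases le_total h k with hhk | hhk
      · rw [abs_of_nonneg (sub_nonneg.2 (hanti u₀ h k hu₀.le hhk)), abs_sub_comm,
          abs_of_nonneg (sub_nonneg.2 hhk)]
        exact key h k hhk
      · rw [abs_sub_comm, abs_of_nonneg (sub_nonneg.2 (hanti u₀ k h hu₀.le hhk)),
          abs_of_nonneg (sub_nonneg.2 hhk)]
        exact key k h hhk
    refine ⟨min (u₀ * (ε / 2)) (ε / 2), by positivity, ?_⟩
    rintro ⟨u, k⟩ ⟨hu', hk⟩ hdist
    rw [Prod.dist_eq, max_lt_iff, lt_min_iff, lt_min_iff, Real.dist_eq, Real.dist_eq] at hdist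
    have e1 := hu u k hu'
    have e2 := hh k h₀
    have e3 : |u - u₀| / u₀ < ε / 2 := by rw [div_lt_iff₀ hu₀]; linarith [hdist.1.1]
    have e4 := hdist.2.2
    simp only at e4
    rw [Real.dist_eq]
    calc |κ u k - κ u₀ h₀| ≤ |κ u k - κ u₀ k| + |κ u₀ k - κ u₀ h₀| := abs_sub_le _ _ _
      _ < ε := by linarith

section Envelope

variable {Q : ℝ → ℝ → ℝ → Prop}

/-- A tent of height `w / (1 + w)` which is attained at `(u', h')`. -/
def tent (u' h' w u h : ℝ) : ℝ := w / (1 + w) * (min 1 (u / u') * min 1 (Real.exp (h' - h)))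

/-- The upper envelope of all tents given by the data `Q`. -/
def envelope (Q : ℝ → ℝ → ℝ → Prop) (u h : ℝ) : ℝ :=
  ⨆ p : {p : ℝ × ℝ × ℝ // Q p.1 p.2.1 p.2.2}, tent p.1.1 p.1.2.1 p.1.2.2 (max u 0) h

/-- The data triples `(u, h, w)` are nonnegative. -/
def NonnegData (Q : ℝ → ℝ → ℝ → Prop) : Prop := ∀ u h w, Q u h w → 0 ≤ u ∧ 0 ≤ h ∧ 0 ≤ w

theorem tent_nonneg {u' h' w u h : ℝ} (hu' : 0 ≤ u') (hw : 0 ≤ w) (hu : 0 ≤ u) :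
    0 ≤ tent u' h' w u h := by
  unfold tent; positivity

theorem tent_le_height {u' h' w u h : ℝ} (hw : 0 ≤ w) :
    tent u' h' w u h ≤ w / (1 + w) := by
  unfold tent
  refine mul_le_of_le_one_right (by positivity) (mul_le_one₀ (min_le_left _ _) (by positivity)
    (min_le_left _ _))

theorem height_le_one {w : ℝ} (hw : 0 ≤ w) : w / (1 + w) ≤ 1 :=
  (div_le_one (by positivity)).2 (by linarith)

theorem height_le_self {w : ℝ} (hw : 0 ≤ w) : w / (1 + w) ≤ w :=
  div_le_self hw (by linarith)

theorem tent_le_ratio {u' h' w u h : ℝ} (hu' : 0 ≤ u') (hw : 0 ≤ w) (hu : 0 ≤ u) :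
    tent u' h' w u h ≤ u / u' := by
  unfold tent
  calc _ ≤ 1 * (u / u' * 1) := by
        gcongr
        · exact height_le_one hw
        · exact min_le_right _ _
        · exact min_le_left _ _
    _ = _ := by ring

theorem tent_le_exp {u' h' w u h : ℝ} (hu' : 0 ≤ u') (hw : 0 ≤ w) (hu : 0 ≤ u) :
    tent u' h' w u h ≤ Real.exp (h' - h) := by
  unfold tent
  calc _ ≤ 1 * (1 * Real.exp (h' - h)) := by
        gcongr
        · exact height_le_one hw
        · exact min_le_left _ _
        · exact min_le_right _ _
    _ = _ := by ring


theorem envelope_nonneg (hQ : NonnegData Q) (u h : ℝ) : 0 ≤ envelope Q u h :=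
  Real.iSup_nonneg fun p => tent_nonneg (hQ _ _ _ p.2).1 (hQ _ _ _ p.2).2.2 (le_max_right _ _)

theorem envelope_le {u h b : ℝ} (hb : 0 ≤ b) (hu : 0 ≤ u)
    (H : ∀ u' h' w, Q u' h' w → tent u' h' w u h ≤ b) : envelope Q u h ≤ b := by
  refine Real.iSup_le (fun p => ?_) hb
  rw [max_eq_left hu]
  exact H _ _ _ p.2

theorem tent_le_envelope (hQ : NonnegData Q)
    {u' h' w : ℝ} (hp : Q u' h' w) {u : ℝ} (hu : 0 ≤ u) (h : ℝ) :
    tent u' h' w u h ≤ envelope Q u h := by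
  have hbdd : BddAbove (range fun p : {p : ℝ × ℝ × ℝ // Q p.1 p.2.1 p.2.2} =>
      tent p.1.1 p.1.2.1 p.1.2.2 (max u 0) h) := by
    refine ⟨1, ?_⟩
    rintro _ ⟨p, rfl⟩
    exact (tent_le_height (hQ _ _ _ p.2).2.2).trans
      (height_le_one (hQ _ _ _ p.2).2.2)
  have := le_ciSup hbdd ⟨(u', h', w), hp⟩
  simp only [max_eq_left hu] at this
  simpa only [envelope, max_eq_left hu] using this

theorem envelope_le_one (hQ : NonnegData Q) {u h : ℝ} (hu : 0 ≤ u) : envelope Q u h ≤ 1 :=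
  envelope_le zero_le_one hu fun _ _ _ hp =>
    (tent_le_height (hQ _ _ _ hp).2.2).trans (height_le_one (hQ _ _ _ hp).2.2)

theorem envelope_mono (hQ : NonnegData Q) {u v h : ℝ} (hu : 0 ≤ u) (huv : u ≤ v) :
    envelope Q u h ≤ envelope Q v h := by
  refine envelope_le (envelope_nonneg hQ _ _) hu fun u' h' w hp => ?_
  refine le_trans ?_ (tent_le_envelope hQ hp (hu.trans huv) h)
  obtain ⟨h1, h2, h3⟩ := hQ _ _ _ hp
  unfold tent
  gcongr

theorem envelope_anti (hQ : NonnegData Q) {u h k : ℝ} (hu : 0 ≤ u) (hhk : h ≤ k) :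
    envelope Q u k ≤ envelope Q u h := by
  refine envelope_le (envelope_nonneg hQ _ _) hu fun u' h' w hp => ?_
  refine le_trans ?_ (tent_le_envelope hQ hp hu h)
  obtain ⟨h1, h2, h3⟩ := hQ _ _ _ hp
  unfold tent
  gcongr

theorem envelope_scale (hQ : NonnegData Q) {u v h : ℝ} (hu : 0 ≤ u) (huv : u ≤ v) :
    u / v * envelope Q v h ≤ envelope Q u h := by
  rcases hu.eq_or_lt with rfl | hupos
  · rw [zero_div, zero_mul]; exact envelope_nonneg hQ _ _
  have hv : 0 < v := hupos.trans_le huv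
  rw [div_mul_eq_mul_div, div_le_iff₀ hv, mul_comm u, ← le_div_iff₀ hupos]
  refine envelope_le (by have := envelope_nonneg hQ u h; positivity) hv.le fun u' h' w hp => ?_
  rw [le_div_iff₀ hupos]
  refine le_trans ?_ (mul_le_mul_of_nonneg_right (tent_le_envelope hQ hp hu h) hv.le)
  obtain ⟨h1, h2, h3⟩ := hQ _ _ _ hp
  have key : min 1 (v / u') * u ≤ min 1 (u / u') * v := by
    rw [min_mul_of_nonneg _ _ hupos.le, min_mul_of_nonneg _ _ hv.le, one_mul, one_mul]
    refine le_min ((min_le_left _ _).trans huv) ((min_le_right _ _).trans (le_of_eq ?_))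
    ring
  unfold tent
  calc _ = w / (1 + w) * ((min 1 (v / u') * u) * min 1 (Real.exp (h' - h))) := by ring
    _ ≤ w / (1 + w) * ((min 1 (u / u') * v) * min 1 (Real.exp (h' - h))) := by gcongr
    _ = _ := by ring

theorem envelope_exp (hQ : NonnegData Q) {u h k : ℝ} (hu : 0 ≤ u) (hhk : h ≤ k) :
    Real.exp (h - k) * envelope Q u h ≤ envelope Q u k := by
  rw [mul_comm, ← le_div_iff₀ (Real.exp_pos _)]
  refine envelope_le (by have := envelope_nonneg hQ u k; positivity) hu fun u' h' w hp => ?_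
  rw [le_div_iff₀ (Real.exp_pos _)]
  refine le_trans ?_ (tent_le_envelope hQ hp hu k)
  obtain ⟨h1, h2, h3⟩ := hQ _ _ _ hp
  have key : min 1 (Real.exp (h' - h)) * Real.exp (h - k) ≤ min 1 (Real.exp (h' - k)) := by
    rw [min_mul_of_nonneg _ _ (Real.exp_pos _).le, one_mul, ← Real.exp_add, sub_add_sub_cancel]
    exact min_le_min_right _ (Real.exp_le_one_iff.2 (by linarith))
  unfold tent
  calc _ = w / (1 + w) * (min 1 (u / u') * (min 1 (Real.exp (h' - h)) * Real.exp (h - k))) := by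
        ring
    _ ≤ _ := by gcongr

theorem envelope_lt_one (hQ : NonnegData Q)
    (hA : ∀ u, ∃ M, ∀ u' h w, Q u' h w → u' ≤ u → w ≤ M) {u : ℝ} (hu : 0 ≤ u)
    (h : ℝ) : envelope Q u h < 1 := by
  obtain ⟨M, hM⟩ := hA (2 * u)
  have hM1 : max M 0 / (1 + max M 0) < 1 := (div_lt_one (by positivity)).2 (by linarith)
  refine lt_of_le_of_lt (envelope_le (b := max (max M 0 / (1 + max M 0)) (1 / 2)) (by positivity)
    hu fun u' h' w hp => ?_) (max_lt hM1 (by norm_num))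
  obtain ⟨h1, h2, h3⟩ := hQ _ _ _ hp
  rcases le_or_gt u' (2 * u) with hle | hgt
  · refine (tent_le_height h3).trans (le_max_of_le_left ?_)
    rw [div_le_div_iff₀ (by positivity) (by positivity)]
    nlinarith [(hM _ _ _ hp hle).trans (le_max_left M 0)]
  · refine (tent_le_ratio h1 h3 hu).trans (le_max_of_le_right ?_)
    rw [div_le_div_iff₀ (by linarith) (by norm_num)]
    linarith

theorem exists_envelope_le (hQ : NonnegData Q)
    (hB : ∀ ε > 0, ∃ δ > 0, ∀ u h w, Q u h w → u ≤ δ → w ≤ ε) {ε : ℝ}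
    (hε : 0 < ε) : ∃ δ > 0, ∀ u h, 0 ≤ u → u ≤ δ → envelope Q u h ≤ ε := by
  obtain ⟨δ, hδ, hQδ⟩ := hB ε hε
  refine ⟨ε * δ, by positivity, fun u h hu huδ => envelope_le hε.le hu fun u' h' w hp => ?_⟩
  obtain ⟨h1, h2, h3⟩ := hQ _ _ _ hp
  rcases le_or_gt u' δ with hle | hgt
  · exact (tent_le_height h3).trans ((height_le_self h3).trans (hQδ _ _ _ hp hle))
  · refine (tent_le_ratio h1 h3 hu).trans ?_
    rw [div_le_iff₀ (by linarith)]
    nlinarith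

theorem tendsto_envelope (hQ : NonnegData Q)
    (hC : ∀ u, ∀ ε > 0, ∃ H, ∀ u' h w, Q u' h w → u' ≤ u → H ≤ h → w ≤ ε)
    {u : ℝ} (hu : 0 ≤ u) : Tendsto (envelope Q u) atTop (nhds 0) := by
  rw [Metric.tendsto_atTop]
  intro ε hε
  obtain ⟨H, hH⟩ := hC (u / (ε / 2)) (ε / 2) (half_pos hε)
  refine ⟨H - Real.log (ε / 2), fun h hh => ?_⟩
  rw [Real.dist_eq, sub_zero, abs_of_nonneg (envelope_nonneg hQ _ _)]
  refine lt_of_le_of_lt (envelope_le (half_pos hε).le hu fun u' h' w hp => ?_) (half_lt_self hε)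
  obtain ⟨h1, h2, h3⟩ := hQ _ _ _ hp
  rcases le_or_gt u' (u / (ε / 2)) with hle | hgt
  · rcases le_total H h' with hHh | hHh
    · exact (tent_le_height h3).trans ((height_le_self h3).trans (hH _ _ _ hp hle hHh))
    · refine (tent_le_exp h1 h3 hu).trans ?_
      rw [← Real.exp_log (half_pos hε)]
      exact Real.exp_le_exp.2 (by linarith)
  · refine (tent_le_ratio h1 h3 hu).trans ?_
    have hu'pos : 0 < u' := lt_of_le_of_lt (by positivity) hgt
    rw [div_lt_iff₀ (half_pos hε)] at hgt
    rw [div_le_iff₀ hu'pos]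
    linarith

/-- Data which are bounded, small for small `u` and small for large `h`, locally uniformly in `u`,
are bounded by a function of class `KL`. -/
theorem exists_isKL_bound (hQ : NonnegData Q)
    (hA : ∀ u, ∃ M, ∀ u' h w, Q u' h w → u' ≤ u → w ≤ M)
    (hB : ∀ ε > 0, ∃ δ > 0, ∀ u h w, Q u h w → u ≤ δ → w ≤ ε)
    (hC : ∀ u, ∀ ε > 0, ∃ H, ∀ u' h w, Q u' h w → u' ≤ u → H ≤ h → w ≤ ε) :
    ∃ σ, IsKL σ ∧ ∀ u h w, Q u h w → w ≤ σ u h := by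
  have hlt : ∀ u h, 0 ≤ u → 0 < 1 - envelope Q u h := fun u h hu =>
    sub_pos.2 (envelope_lt_one hQ hA hu h)
  have hcont : ContinuousOn (fun p : ℝ × ℝ => envelope Q p.1 p.2) (Ici 0 ×ˢ Ici 0) := by
    refine continuousOn_quadrant_of_monotone (envelope_nonneg hQ)
      (fun u h hu => envelope_le_one hQ hu) (fun u v h => envelope_mono hQ)
      (fun u h k => envelope_anti hQ) (fun u v h => envelope_scale hQ)
      (fun u h k => envelope_exp hQ) fun ε hε => ?_
    obtain ⟨δ, hδ, h⟩ := exists_envelope_le hQ hB hε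
    exact ⟨δ, hδ, fun u k hu huδ _ => h u k hu huδ⟩
  have hfrac : ∀ u v h k, 0 ≤ u → 0 ≤ v → envelope Q u h ≤ envelope Q v k →
      envelope Q u h / (1 - envelope Q u h) ≤ envelope Q v k / (1 - envelope Q v k) := by
    intro u v h k hu hv hle
    rw [div_le_div_iff₀ (hlt u h hu) (hlt v k hv)]
    linarith
  refine ⟨fun u h => envelope Q u h / (1 - envelope Q u h) + u * Real.exp (-h),
    ⟨?_, ?_, ?_, ?_, ?_⟩, ?_⟩
  · refine ContinuousOn.add (hcont.div (continuousOn_const.sub hcont) fun p hp =>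
      (hlt p.1 p.2 hp.1).ne') (by fun_prop)
  · intro u h hu _
    have := envelope_nonneg hQ u h
    have := hlt u h hu
    positivity
  · intro h _
    refine ⟨fun u hu v hv huv => ?_, ?_⟩
    · refine add_lt_add_of_le_of_lt (hfrac u v h h hu hv (envelope_mono hQ hu huv.le)) ?_
      gcongr
    · have : envelope Q 0 h = 0 := le_antisymm
        (le_of_forall_pos_le_add fun ε hε => by
          obtain ⟨δ, hδ, hle⟩ := exists_envelope_le hQ hB hε
          rw [zero_add]
          exact hle 0 h le_rfl hδ.le) (envelope_nonneg hQ _ _)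
      simp [this]
  · intro u hu h _ k _ hhk
    refine add_le_add (hfrac u u k h hu hu (envelope_anti hQ hu hhk)) ?_
    gcongr
  · intro u hu
    have h1 := tendsto_envelope hQ hC hu
    have h2 := h1.div (tendsto_const_nhds.sub h1) (show (1 : ℝ) - 0 ≠ 0 by norm_num)
    have h3 := (Real.tendsto_exp_neg_atTop_nhds_zero).const_mul u
    simpa using h2.add h3
  · intro u h w hp
    obtain ⟨h1, h2, h3⟩ := hQ _ _ _ hp
    have hen : w / (1 + w) ≤ envelope Q u h := by
      rcases h1.eq_or_lt with rfl | hu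
      · have : w ≤ 0 := le_of_forall_pos_le_add fun ε hε => by
          obtain ⟨δ, hδ, hle⟩ := hB ε hε
          rw [zero_add]
          exact hle _ _ _ hp hδ.le
        exact ((height_le_self h3).trans this).trans (envelope_nonneg hQ _ _)
      · refine le_trans (le_of_eq ?_) (tent_le_envelope hQ hp h1 h)
        simp [tent, div_self hu.ne']
    rw [div_le_iff₀ (by positivity)] at hen
    refine le_add_of_le_of_nonneg ?_ (by positivity)
    rw [le_div_iff₀ (hlt u h h1)]
    linarith

end Envelope

/-- A function on the line which is bounded above on every half-line `(-∞, C]` has a continuous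
majorant. -/
theorem exists_continuous_majorant {b : ℝ → ℝ} (hb : ∀ C, ∃ M, ∀ t ≤ C, b t ≤ M) :
    ∃ g : C(ℝ, ℝ), ∀ t, b t ≤ g t := by
  refine exists_continuous_forall_mem_convex_of_local_const (t := fun t => Ici (b t))
    (fun t => convex_Ici _) fun t => ?_
  obtain ⟨M, hM⟩ := hb (t + 1)
  exact ⟨M, (eventually_le_nhds (lt_add_one t)).mono fun s hs => hM s hs⟩

/-- Data which are bounded, small for small `s` and small for large `h`, locally uniformly in the
initial time `T`, are bounded by `σ (β T * s) h` with `σ` of class `KL` and `β` of class `K⁺`. -/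
theorem exists_isKL_weight_bound {Q : ℝ → ℝ → ℝ → ℝ → Prop}
    (hQ : ∀ T s h w, Q T s h w → 0 ≤ T ∧ 0 ≤ s ∧ 0 ≤ h ∧ 0 ≤ w)
    (hA : ∀ T s, 0 ≤ s → ∃ M, ∀ T' s' h w, Q T' s' h w → T' ≤ T → s' ≤ s → w ≤ M)
    (hB : ∀ T, ∀ ε > 0, ∃ δ > 0, ∀ T' s h w, Q T' s h w → T' ≤ T → s ≤ δ → w ≤ ε)
    (hC : ∀ T s, 0 ≤ s → ∀ ε > 0, ∃ H, ∀ T' s' h w, Q T' s' h w → T' ≤ T → s' ≤ s → H ≤ h →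
      w ≤ ε) :
    ∃ σ, ∃ β, IsKL σ ∧ IsKPlus β ∧ ∀ T s h w, Q T s h w → w ≤ σ (β T * s) h := by
  choose δ hδ hQδ using fun k : ℕ => hB (k + 1) (1 / (k + 1)) (by positivity)
  obtain ⟨β, hβ⟩ := exists_continuous_majorant
    (b := fun T => max 1 ((⌊T⌋₊ + 1) / δ ⌊T⌋₊)) (by
      intro C
      obtain ⟨M, hM⟩ := ((Finset.range (⌊C⌋₊ + 1)).image
        fun k : ℕ => max 1 ((k + 1) / δ k)).bddAbove
      exact ⟨M, fun t ht => hM (Finset.mem_coe.2 (Finset.mem_image_of_mem _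
        (Finset.mem_range.2 (Nat.lt_succ_of_le (Nat.floor_mono ht)))))⟩)
  have hβ1 : ∀ T, 1 ≤ β T := fun T => (le_max_left _ _).trans (hβ T)
  have hlate : ∀ k : ℕ, ∀ T s h w, Q T s h w → (k : ℝ) ≤ T → β T * s ≤ k + 1 →
      w ≤ 1 / (k + 1) := by
    intro k T s h w hp hkT hs
    obtain ⟨hT, hs0, -, -⟩ := hQ _ _ _ _ hp
    have hkf : (k : ℝ) ≤ ⌊T⌋₊ := Nat.cast_le.2 (Nat.le_floor hkT)
    refine (hQδ ⌊T⌋₊ T s h w hp (Nat.lt_floor_add_one T).le ?_).trans (by gcongr)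
    have h1 : (⌊T⌋₊ + 1) / δ ⌊T⌋₊ ≤ β T := (le_max_right _ _).trans (hβ T)
    rw [div_le_iff₀ (hδ _)] at h1
    have h2 : β T * s ≤ β T * δ ⌊T⌋₊ := by linarith
    exact le_of_mul_le_mul_left h2 (by linarith [hβ1 T])
  have hsle : ∀ T s h w u, Q T s h w → β T * s ≤ u → s ≤ u := fun T s h w u hp hu =>
    (le_mul_of_one_le_left (hQ _ _ _ _ hp).2.1 (hβ1 T)).trans hu
  obtain ⟨σ, hσ, hQσ⟩ := exists_isKL_bound (Q := fun u h w => ∃ T s, u = β T * s ∧ Q T s h w)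
    (by
      rintro _ h w ⟨T, s, rfl, hp⟩
      obtain ⟨-, h1, h2, h3⟩ := hQ _ _ _ _ hp
      exact ⟨mul_nonneg (by linarith [hβ1 T]) h1, h2, h3⟩)
    (by
      intro u
      obtain ⟨k, hk⟩ := exists_nat_ge u
      obtain ⟨M, hM⟩ := hA k (max u 0) (le_max_right _ _)
      refine ⟨max M 1, ?_⟩
      rintro _ h w ⟨T, s, rfl, hp⟩ hu
      rcases le_total T k with hT | hT
      · exact le_max_of_le_left (hM T s h w hp hT ((hsle _ _ _ _ _ hp hu).trans (le_max_left _ _)))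
      · refine le_max_of_le_right ((hlate k T s h w hp hT (by linarith)).trans ?_)
        exact (div_le_one (by positivity)).2 (by linarith [(Nat.cast_nonneg k : (0 : ℝ) ≤ k)]))
    (by
      intro ε hε
      obtain ⟨k, hk⟩ := exists_nat_one_div_lt hε
      obtain ⟨δ', hδ', hM⟩ := hB k ε hε
      refine ⟨min δ' 1, by positivity, ?_⟩
      rintro _ h w ⟨T, s, rfl, hp⟩ hu
      rcases le_total T k with hT | hT
      · exact hM T s h w hp hT ((hsle _ _ _ _ _ hp hu).trans (min_le_left _ _))
      · exact (hlate k T s h w hp hT (by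
          linarith [(Nat.cast_nonneg k : (0 : ℝ) ≤ k), min_le_right δ' 1])).trans hk.le)
    (by
      intro u ε hε
      obtain ⟨i, hi⟩ := exists_nat_ge u
      obtain ⟨j, hj⟩ := exists_nat_one_div_lt hε
      obtain ⟨H, hH⟩ := hC (max i j : ℕ) (max u 0) (le_max_right _ _) ε hε
      refine ⟨H, ?_⟩
      rintro _ h w ⟨T, s, rfl, hp⟩ hu hHh
      have hi' : (i : ℝ) ≤ (max i j : ℕ) := Nat.cast_le.2 (le_max_left _ _)
      have hj' : (j : ℝ) ≤ (max i j : ℕ) := Nat.cast_le.2 (le_max_right _ _)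
      rcases le_total T (max i j : ℕ) with hT | hT
      · exact hH T s h w hp hT ((hsle _ _ _ _ _ hp hu).trans (le_max_left _ _)) hHh
      · refine ((hlate _ T s h w hp hT (by linarith)).trans ?_).trans hj.le
        gcongr)
  exact ⟨σ, β, hσ, ⟨β.continuous.continuousOn, fun t _ => by linarith [hβ1 t]⟩,
    fun T s h w hp => hQσ _ _ _ ⟨T, s, rfl, hp⟩⟩

/-! ### Robust stability from uniform attraction -/

theorem SolOn.zero {n l : ℕ} {D : Set (Euc l)} {f : ℝ → (ℝ → Euc n) → Euc l → Euc n}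
    (hf0 : ∀ t d, 0 ≤ t → d ∈ D → f t (fun _ => (0 : Euc n)) d = 0) {d : ℝ → Euc l}
    (hd : MD l D d) {a : ℝ} (ha : 0 ≤ a) (b : ℝ) : SolOn n l f d a b fun _ => 0 := by
  refine ⟨continuous_const, fun t ht => ?_⟩
  rw [zero_add, intervalIntegral.integral_congr (g := fun _ => 0), intervalIntegral.integral_zero]
  intro s hs
  rw [uIcc_of_le ht.1] at hs
  exact hf0 s _ (ha.trans hs.1) (hd.1 s (ha.trans hs.1))

/-- Solutions which are uniformly attracted to the origin, in the presence of a functional with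
at most affine growth, admit a `KL` estimate. -/
theorem GrowthFunctional.rgasnu {n l : ℕ} {r q : ℝ} {D : Set (Euc l)}
    {f : ℝ → (ℝ → Euc n) → Euc l → Euc n} {V : ℝ → (ℝ → Euc n) → ℝ} {a₁ a₂ β₁ : ℝ → ℝ}
    (G : GrowthFunctional n l r q D f V a₁ a₂ β₁)
    (hf0 : ∀ t d, 0 ≤ t → d ∈ D → f t (fun _ => (0 : Euc n)) d = 0)
    (hattr : ∀ T s, 0 ≤ s → ∀ ε > 0, ∃ H, ∀ d, MD l D d → ∀ a x, 0 ≤ a → a ≤ T →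
      (∀ b, SolOn n l f d a b x) → (∀ t ≤ a, ‖x t‖ ≤ s) → ∀ t, H ≤ t → ‖x t‖ ≤ ε) :
    RGASnu n l r D f := by
  have hr := G.delay_nonneg
  have hC : ∀ T s, 0 ≤ s → ∀ ε > 0, ∃ H, ∀ d, MD l D d → ∀ a x, 0 ≤ a → a ≤ T →
      (∀ b, SolOn n l f d a b x) → (∀ t ≤ a, ‖x t‖ ≤ s) → ∀ h, H ≤ h →
        histNorm n r (fun θ => x (a + h + θ)) ≤ ε := by
    intro T s hs ε hε
    obtain ⟨H, hH⟩ := hattr T s hs ε hε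
    refine ⟨H + r, fun d hd a x ha haT hx hxs h hh => histNorm_le hε.le fun θ hθ => ?_⟩
    exact hH d hd a x ha haT hx hxs _ (by linarith [hθ.1])
  have hA : ∀ T s, 0 ≤ s → ∃ M, ∀ d, MD l D d → ∀ a x, 0 ≤ a → a ≤ T →
      (∀ b, SolOn n l f d a b x) → (∀ t ≤ a, ‖x t‖ ≤ s) → ∀ t, ‖x t‖ ≤ M := by
    intro T s hs
    obtain ⟨H, hH⟩ := hattr T s hs 1 one_pos
    obtain ⟨M, hM0, hM⟩ := G.exists_bound (max H T) hs
    refine ⟨max (max s 1) M, fun d hd a x ha haT hx hxs t => ?_⟩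
    rcases le_total t a with hta | hta
    · exact ((hxs t hta).trans (le_max_left _ _)).trans (le_max_left _ _)
    rcases le_total H t with hHt | hHt
    · exact ((hH d hd a x ha haT hx hxs t hHt).trans (le_max_right _ _)).trans (le_max_left _ _)
    · exact (hM d hd a _ x ha hta (hHt.trans (le_max_left _ _)) (hx t) hxs t
        ⟨hta, le_rfl⟩).2.trans (le_max_right _ _)
  have hB : ∀ T, ∀ ε > 0, ∃ δ > 0, ∀ d, MD l D d → ∀ a x, 0 ≤ a → a ≤ T →
      (∀ b, SolOn n l f d a b x) → ∀ s ≤ δ, (∀ t ≤ a, ‖x t‖ ≤ s) → ∀ t, ‖x t‖ ≤ ε := by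
    intro T ε hε
    obtain ⟨H, hH⟩ := hattr T 1 zero_le_one ε hε
    obtain ⟨M, hM⟩ := hA T 1 zero_le_one
    obtain ⟨L, hL0, hL⟩ := exists_gronwall_constant hr G.h1 G.h2 G.h3 (max H T) (M := max M 0)
      (le_max_right _ _)
    refine ⟨min (min 1 ε) (ε * Real.exp (-(L * |H|))), by positivity,
      fun d hd a x ha haT hx s hs hxs t => ?_⟩
    have hs1 : s ≤ 1 := hs.trans ((min_le_left _ _).trans (min_le_left _ _))
    have hsε : s ≤ ε := hs.trans ((min_le_left _ _).trans (min_le_right _ _))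
    have hse : s ≤ ε * Real.exp (-(L * |H|)) := hs.trans (min_le_right _ _)
    have hxs1 : ∀ t ≤ a, ‖x t‖ ≤ 1 := fun t ht => (hxs t ht).trans hs1
    have hs0 : 0 ≤ s := (norm_nonneg _).trans (hxs a le_rfl)
    rcases le_total t a with hta | hta
    · exact (hxs t hta).trans hsε
    rcases le_total H t with hHt | hHt
    · exact hH d hd a x ha haT hx hxs1 t hHt
    have key := hL d hd a t x (fun _ => 0) ha hta (hHt.trans (le_max_left _ _)) (hx t)
      (SolOn.zero hf0 hd ha t)
      (fun u _ => (hM d hd a x ha haT hx hxs1 u).trans (le_max_left _ _)) (fun u _ => by simp)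
      s hs0 (fun u hu => by simpa using hxs u hu.2) t ⟨hta, le_rfl⟩
    rw [sub_zero] at key
    calc ‖x t‖ ≤ s * Real.exp (L * (t - a)) := key
      _ ≤ ε * Real.exp (-(L * |H|)) * Real.exp (L * |H|) := by
          gcongr
          linarith [le_abs_self H]
      _ = ε := by rw [mul_assoc, ← Real.exp_add]; simp
  obtain ⟨σ, β, hσ, hβ, hest⟩ := exists_isKL_weight_bound
    (Q := fun T s h w => ∃ d x, MD l D d ∧ 0 ≤ T ∧ 0 ≤ h ∧ (∀ b, SolOn n l f d T b x) ∧
      (∀ t ≤ T, ‖x t‖ ≤ s) ∧ w = histNorm n r fun θ => x (T + h + θ))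
    (by
      rintro T s h _ ⟨d, x, -, hT, hh, -, hxs, rfl⟩
      exact ⟨hT, (norm_nonneg _).trans (hxs T le_rfl), hh, histNorm_nonneg⟩)
    (by
      intro T s hs
      obtain ⟨M, hM⟩ := hA T s hs
      refine ⟨M, ?_⟩
      rintro T' s' h _ ⟨d, x, hd, hT', -, hx, hxs, rfl⟩ hTT hss
      have hbd := hM d hd T' x hT' hTT hx fun t ht => (hxs t ht).trans hss
      exact histNorm_le ((norm_nonneg _).trans (hbd 0)) fun θ _ => hbd _)
    (by
      intro T ε hε
      obtain ⟨δ, hδ, hM⟩ := hB T ε hε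
      refine ⟨δ, hδ, ?_⟩
      rintro T' s h _ ⟨d, x, hd, hT', -, hx, hxs, rfl⟩ hTT hss
      exact histNorm_le hε.le fun θ _ => hM d hd T' x hT' hTT hx s hss hxs _)
    (by
      intro T s hs ε hε
      obtain ⟨H, hH⟩ := hC T s hs ε hε
      refine ⟨H, ?_⟩
      rintro T' s' h _ ⟨d, x, hd, hT', -, hx, hxs, rfl⟩ hTT hss hHh
      exact hH d hd T' x hT' hTT hx (fun t ht => (hxs t ht).trans hss) h hHh)
  refine ⟨σ, β, hσ, hβ, fun t₀ x₀ d ht₀ hx₀ hd => ?_, fun t₀ x₀ d x ht₀ hx₀ hd hx hini t ht => ?_⟩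
  · have hmem : ∀ t, max (-r) (min 0 (t - t₀)) ∈ Icc (-r) 0 := fun t =>
      ⟨le_max_left _ _, max_le (by linarith) (min_le_left _ _)⟩
    obtain ⟨x, hxφ, hx⟩ := G.exists_global hd ht₀
      (φ := fun t => x₀ (max (-r) (min 0 (t - t₀))))
      (hx₀.comp_continuous (by fun_prop) hmem) histNorm_nonneg
      (fun t _ => norm_le_histNorm hx₀ (hmem t))
    refine ⟨x, isSolGlobal_of_solOn G.h2 G.h3 hd ht₀ hx, fun θ hθ => ?_⟩
    rw [hxφ _ (by linarith [hθ.2]), add_sub_cancel_left, min_eq_right hθ.2, max_eq_right hθ.1]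
  · refine hest t₀ (histNorm n r x₀) (t - t₀) _ ⟨d, fun t => x (max t (t₀ - r)), hd, ht₀,
      sub_nonneg.2 ht, fun b => hx.solOn hr G.h3 hd ht₀ b, fun u hu => ?_, ?_⟩
    · have hmem : max u (t₀ - r) - t₀ ∈ Icc (-r) 0 :=
        ⟨by linarith [le_max_right u (t₀ - r)], by
          linarith [max_le hu (show t₀ - r ≤ t₀ by linarith)]⟩
      have := hini _ hmem
      rw [add_sub_cancel] at this
      simp only [this]
      exact norm_le_histNorm hx₀ hmem
    · unfold histNorm
      congr 1
      refine image_congr fun θ hθ => ?_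
      simp only
      rw [max_eq_left (by linarith [hθ.1]), add_sub_cancel]

/-- **Theorem 2.9, (c) ⇒ (a).** Under hypotheses (H1)-(H4), the existence of a
lower semicontinuous functional `V` on `[0,∞) × C([-r-τ,0];ℝⁿ)` with the bounds (2.17),
the growth condition (2.18a) everywhere and the infinitesimal decrease property (2.18b) on
the sets `S(t)` of (2.19a,b) (where `ηc = η(·,0,c)` solves `η̇ = -ρ(η) + μ(t)`, `η(0) = c`)
implies that `0` is non-uniformly in time RGAS. -/
theorem stmt9 (n l : ℕ) (r τ : ℝ) (hr : 0 ≤ r) (hτ : 0 ≤ τ)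
    (D : Set (Euc l)) (hD : D.Nonempty)
    (f : ℝ → (ℝ → Euc n) → Euc l → Euc n)
    (hf0 : ∀ t d, 0 ≤ t → d ∈ D → f t (fun _ => (0 : Euc n)) d = 0)
    (h1 : H1 n l r D f) (h2 : H2 n l r D f) (h3 : H3 n l r D f) (h4 : H4 n l r D f)
    (V : ℝ → (ℝ → Euc n) → ℝ)
    (hVnn : ∀ t x, 0 ≤ t → ContinuousOn x (Icc (-(r + τ)) 0) → 0 ≤ V t x)
    (hVlsc : ∀ t x, 0 ≤ t → ContinuousOn x (Icc (-(r + τ)) 0) → ∀ ε > 0, ∃ δ > 0,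
      ∀ t' x', 0 ≤ t' → ContinuousOn x' (Icc (-(r + τ)) 0) →
        |t' - t| + histNorm n (r + τ) (x' - x) < δ → V t x - ε < V t' x')
    (R c : ℝ) (hR : 0 ≤ R) (hc : 0 < c)
    (a₁ a₂ : ℝ → ℝ) (ha₁ : IsKInf a₁) (ha₂ : IsKInf a₂)
    (β₁ β₂ β₃ β₄ : ℝ → ℝ)
    (hβ₁ : IsKPlus β₁) (hβ₂ : IsKPlus β₂) (hβ₃ : IsKPlus β₃) (hβ₄ : IsKPlus β₄)
    (hβ₄div : Filter.Tendsto (fun T => ∫ s in (0:ℝ)..T, β₄ s) Filter.atTop Filter.atTop)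
    (μ : ℝ → ℝ) (hμcont : ContinuousOn μ (Ici 0)) (hμnn : ∀ t, 0 ≤ t → 0 ≤ μ t)
    (hμint : IntegrableOn μ (Ici 0)) (hμ0 : Filter.Tendsto μ Filter.atTop (nhds 0))
    (ρ : ℝ → ℝ) (hρ0 : ρ 0 = 0) (hρpos : ∀ s, 0 < s → 0 < ρ s)
    (hρlip : ∀ Rl : ℝ, 0 ≤ Rl → ∃ K : NNReal, LipschitzOnWith K ρ (Icc 0 Rl))
    (ηc : ℝ → ℝ) (hηc0 : ηc 0 = c)
    (hηcode : ∀ t, 0 ≤ t → HasDerivAt ηc (-(ρ (ηc t)) + μ t) t)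
    (Sbar : ℝ → Set (ℝ → Euc n))
    (hSbar : ∀ t, 0 ≤ t → ∀ x : ℝ → Euc n, ContinuousOn x (Icc (-(r + τ)) 0) →
      ηc (∫ s in (0:ℝ)..t, β₄ s) ≤ a₂ (β₁ t * histNorm n (r + τ) x) → x ∈ Sbar t)
    (hbound : ∀ t x, 0 ≤ t → ContinuousOn x (Icc (-(r + τ)) 0) →
      a₁ ‖x 0‖ ≤ V t x ∧ V t x ≤ a₂ (β₁ t * histNorm n (r + τ) x))
    (hdecr1 : ∀ t x d, 0 ≤ t → ContinuousOn x (Icc (-(r + τ)) 0) → d ∈ D →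
      Vdot n (r + τ) V t x (f t x d) ≤ ((β₂ t * V t x + R * β₃ t : ℝ) : EReal))
    (hdecr2 : ∀ t x d, τ ≤ t → ContinuousOn x (Icc (-(r + τ)) 0) → d ∈ D →
      x ∈ Sbar t →
      (∃ dd : ℝ → Euc l, MD l D dd ∧ ∀ θ ∈ Icc (-τ) 0,
        x θ = x (-τ) + ∫ s in (-τ)..θ, f (t + s) (fun θ' => x (s + θ')) (dd (τ + s))) →
      Vdot n (r + τ) V t x (f t x d) ≤
        ((-(β₄ t * ρ (V t x)) + β₄ t * μ (∫ s in (0:ℝ)..t, β₄ s) : ℝ) : EReal)) :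
    RGASnu n l r D f := by
  have G : GrowthFunctional n l r (r + τ) D f V a₁ a₂ β₁ := by
    refine ⟨hr, h1, h2, h3, hVnn, hVlsc, ha₁, ha₂, hβ₁, hbound, fun T => ?_⟩
    obtain ⟨K, hK⟩ := (isCompact_Icc (a := (0 : ℝ)) (b := T)).exists_bound_of_continuousOn
      (hβ₂.1.mono Icc_subset_Ici_self)
    obtain ⟨B, hB⟩ := (isCompact_Icc (a := (0 : ℝ)) (b := T)).exists_bound_of_continuousOn
      (hβ₃.1.mono Icc_subset_Ici_self)
    refine ⟨max K 0, R * max B 0, le_max_right _ _, by positivity,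
      fun t x d ht htT hx hd => (hdecr1 t x d ht hx hd).trans (EReal.coe_le_coe_iff.2 ?_)⟩
    have hV := hVnn t x ht hx
    have hK' : β₂ t ≤ max K 0 :=
      ((le_abs_self _).trans (hK t ⟨ht, htT⟩)).trans (le_max_left _ _)
    have hB' : β₃ t ≤ max B 0 :=
      ((le_abs_self _).trans (hB t ⟨ht, htT⟩)).trans (le_max_left _ _)
    gcongr
  have hρcont : ContinuousOn ρ (Ici 0) := by
    intro t ht
    obtain ⟨K, hK⟩ := hρlip (t + 1) (add_nonneg ht zero_le_one)
    refine (hK.continuousOn t ⟨ht, (lt_add_one t).le⟩).mono_of_mem_nhdsWithin ?_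
    exact mem_nhdsWithin.2 ⟨Iio (t + 1), isOpen_Iio, lt_add_one t, fun s hs => ⟨hs.2, hs.1.le⟩⟩
  refine G.rgasnu hf0 fun T s hs ε hε => ?_
  refine G.exists_attraction_time hτ hβ₄ hβ₄div hμcont hμnn hμint hρcont hρ0 hρpos hηcode
    (fun t x d ht hx hd hηV hS => ?_) T hs hε
  have ht0 : 0 ≤ t := hτ.trans ht
  exact hdecr2 t x d ht hx hd (hSbar t ht0 x hx (hηV.trans (hbound t x ht0 hx).2)) hS

end
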